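/- arXiv:0809.0064 — 12 statements merged into one kernel-verified Lean document; each statement's English description precedes it below -/
import Mathlib

section
/- Let (Ω,F,P) be a probability space, (Φ,d) a metric space and T a nonempty set. Let Λ : Φ × T → ℝ be a deterministic function, Λ_n : Ω × Φ × T → ℝ be maps, β : T → Φ be a map and β̂_n : Ω × T → Φ be maps. Assume: (i) sup_{φ∈Φ} sup_{t∈T} max(Λ(φ,t) − Λ_n(ω,φ,t), 0) converges to 0 in outer probability; (ii) sup_{t∈T} |Λ_n(ω,β(t),t) − Λ(β(t),t)| converges to 0 in outer probability; (iii) for every ε > 0, inf_{t∈T} [ inf{Λ(φ,t) : φ ∈ Φ, d(φ,β(t)) ≥ ε} − Λ(β(t),t) ] > 0; (iv) sup_{t∈T} max(Λ_n(ω,β̂_n(ω,t),t) − Λ_n(ω,β(t),t), 0) converges to 0 in outer probability. Then sup_{t∈T} d(β̂_n(ω,t), β(t)) converges to 0 in outer probability. -/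
open MeasureTheory Filter Topology
open scoped ENNReal

/-- A sequence of (possibly nonmeasurable) nonnegative maps `Yₙ : Ω → ℝ≥0∞` converges to `0`
in outer probability.  Note that in Mathlib a measure applied to an arbitrary set `A` is
exactly the outer probability `P*(A) = inf {P B : B measurable, A ⊆ B}`
(see `MeasureTheory.measure_eq_iInf`). -/
def TendstoOuterZero {Ω : Type*} [MeasurableSpace Ω] (P : Measure Ω)
    (Y : ℕ → Ω → ℝ≥0∞) : Prop :=
  ∀ ε : ℝ, 0 < ε → Tendsto (fun n => P {ω | ENNReal.ofReal ε ≤ Y n ω}) atTop (𝓝 0)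

/-- Pathwise uniform consistency of M-estimators (Proposition 1 of the paper). -/
theorem pathwise_uniform_consistency
    {Ω : Type*} [MeasurableSpace Ω] (P : Measure Ω) [IsProbabilityMeasure P]
    {Φ : Type*} [MetricSpace Φ] {T : Type*} [Nonempty T]
    (Λ : Φ → T → ℝ) (Λn : ℕ → Ω → Φ → T → ℝ)
    (β : T → Φ) (βhat : ℕ → Ω → T → Φ)
    -- (i) sup_{φ∈Φ} sup_{t∈T} (Λ(φ,t) − Λₙ(ω,φ,t))₊ → 0 in outer probability
    (h1 : TendstoOuterZero P fun n ω =>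
      ⨆ φ : Φ, ⨆ t : T, ENNReal.ofReal (max (Λ φ t - Λn n ω φ t) 0))
    -- (ii) sup_{t∈T} |Λₙ(ω,β(t),t) − Λ(β(t),t)| → 0 in outer probability
    (h2 : TendstoOuterZero P fun n ω =>
      ⨆ t : T, ENNReal.ofReal |Λn n ω (β t) t - Λ (β t) t|)
    -- (iii) for every ε > 0, inf_{t∈T} [inf {Λ(φ,t) : d(φ,β(t)) ≥ ε} − Λ(β(t),t)] > 0
    (h3 : ∀ ε : ℝ, 0 < ε → ∃ c : ℝ, 0 < c ∧ ∀ (t : T) (φ : Φ),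
      ε ≤ dist φ (β t) → Λ (β t) t + c ≤ Λ φ t)
    -- (iv) sup_{t∈T} (Λₙ(ω,β̂ₙ(ω,t),t) − Λₙ(ω,β(t),t))₊ → 0 in outer probability
    (h4 : TendstoOuterZero P fun n ω =>
      ⨆ t : T, ENNReal.ofReal (max (Λn n ω (βhat n ω t) t - Λn n ω (β t) t) 0)) :
    -- conclusion : sup_{t∈T} d(β̂ₙ(ω,t),β(t)) → 0 in outer probability
    TendstoOuterZero P fun n ω => ⨆ t : T, edist (βhat n ω t) (β t) := by
  intro ε hε
  obtain ⟨c, hc, hsep⟩ := h3 (ε / 2) (half_pos hε)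
  have hc3 : 0 < c / 3 := by positivity
  have hlim := ((h1 _ hc3).add (h2 _ hc3)).add (h4 _ hc3)
  simp only [add_zero] at hlim
  refine tendsto_of_tendsto_of_tendsto_of_le_of_le tendsto_const_nhds hlim
    (fun _ => zero_le) fun n => ?_
  refine (measure_mono ?_).trans
    ((measure_union_le _ _).trans (add_le_add_left (measure_union_le _ _) _))
  intro ω hω
  by_contra hcon
  simp only [Set.mem_union, Set.mem_ofPred_eq, not_or, not_le] at hcon hω
  obtain ⟨⟨hω1, hω2⟩, hω4⟩ := hcon
  have hlt : ENNReal.ofReal (ε / 2) < ⨆ t : T, edist (βhat n ω t) (β t) :=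
    ((ENNReal.ofReal_lt_ofReal_iff hε).2 (half_lt_self hε)).trans_le hω
  obtain ⟨t, ht⟩ := lt_iSup_iff.1 hlt
  rw [edist_dist] at ht
  have hd := hsep t (βhat n ω t) (ENNReal.ofReal_lt_ofReal_iff_of_nonneg (half_pos hε).le |>.1 ht).le
  have b1 := (le_iSup₂ (f := fun (φ : Φ) (t : T) =>
    ENNReal.ofReal (max (Λ φ t - Λn n ω φ t) 0)) (βhat n ω t) t).trans_lt hω1
  have b2 := (le_iSup (fun t : T =>
    ENNReal.ofReal |Λn n ω (β t) t - Λ (β t) t|) t).trans_lt hω2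
  have b4 := (le_iSup (fun t : T =>
    ENNReal.ofReal (max (Λn n ω (βhat n ω t) t - Λn n ω (β t) t) 0)) t).trans_lt hω4
  rw [ENNReal.ofReal_lt_ofReal_iff hc3] at b1 b2 b4
  have a1 := (le_max_left _ _).trans_lt b1
  have a2 := (le_abs_self _).trans_lt b2
  have a4 := (le_max_left _ _).trans_lt b4
  linarith
end

section
/- Let (Ω,F,P) be a probability space, (Φ,d) a metric space, M : Φ → ℝ a function, M_n : Ω × Φ → ℝ maps with each M_n(·,φ) measurable, and β ∈ Φ. Assume: (i) sup_{φ∈Φ} max(M(φ) − M_n(ω,φ), 0) converges to 0 in outer probability; (ii) M_n(β) → M(β) in probability; (iii) for all ε > 0, inf{M(φ) : φ ∈ Φ, d(φ,β) ≥ ε} > M(β). Let J_n : Φ → [0,∞) be functions with J_n(β) → 0, set Λ_n(ω,φ,t) = M_n(ω,φ) + t·J_n(φ), let T be a compact subset of [0,∞), and let β̂_n : Ω × T → Φ be maps such that sup_{t∈T} max(Λ_n(ω,β̂_n(ω,t),t) − Λ_n(ω,β,t), 0) converges to 0 in outer probability. Then sup_{t∈T} d(β̂_n(ω,t), β) converges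 to 0 in outer probability. -/
open MeasureTheory Filter Topology
open scoped ENNReal

/-- A real family is bounded strictly by `δ` once the supremum of its positive parts is. -/
lemma lt_of_iSup_ofReal_max_lt {ι : Sort*} {f : ι → ℝ} {δ : ℝ} (hδ : 0 < δ)
    (h : ⨆ i, ENNReal.ofReal (max (f i) 0) < ENNReal.ofReal δ) (i : ι) : f i < δ :=
  (le_max_left _ _).trans_lt <| (ENNReal.ofReal_lt_ofReal_iff hδ).1 <|
    (le_iSup (fun i => ENNReal.ofReal (max (f i) 0)) i).trans_lt h

/-- Uniform consistency of penalized M-estimators (Theorem 3 of the paper):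
the regularization path `β̂ₙ(t)` of the penalized contrast `Λₙ(ω,φ,t) = Mₙ(ω,φ) + t·Jₙ(φ)`
converges to `β` uniformly in `t ∈ T`, in outer probability. -/
theorem penalized_uniform_consistency
    {Ω : Type*} [MeasurableSpace Ω] (P : Measure Ω) [IsProbabilityMeasure P]
    {Φ : Type*} [MetricSpace Φ]
    (M : Φ → ℝ) (Mn : ℕ → Ω → Φ → ℝ) (β : Φ)
    (hmeas : ∀ n φ, Measurable fun ω => Mn n ω φ)
    -- (i) sup_{φ∈Φ} (M(φ) − Mₙ(ω,φ))₊ → 0 in outer probability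
    (h1 : TendstoOuterZero P fun n ω =>
      ⨆ φ : Φ, ENNReal.ofReal (max (M φ - Mn n ω φ) 0))
    -- (ii) Mₙ(β) → M(β) in probability
    (h2 : ∀ ε : ℝ, 0 < ε →
      Tendsto (fun n => P {ω | ε ≤ |Mn n ω β - M β|}) atTop (𝓝 0))
    -- (iii) for every ε > 0, inf {M(φ) : d(φ,β) ≥ ε} > M(β)
    (h3 : ∀ ε : ℝ, 0 < ε → ∃ c : ℝ, 0 < c ∧ ∀ φ : Φ,
      ε ≤ dist φ β → M β + c ≤ M φ)
    -- penalty : nonnegative with Jₙ(β) → 0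
    (J : ℕ → Φ → ℝ) (hJnonneg : ∀ n φ, 0 ≤ J n φ)
    (hJβ : Tendsto (fun n => J n β) atTop (𝓝 0))
    -- T compact subset of [0,∞)
    (T : Set ℝ) (hTcompact : IsCompact T) (hTsub : T ⊆ Set.Ici 0) (hTne : T.Nonempty)
    (βhat : ℕ → Ω → ℝ → Φ)
    -- β̂ₙ near-minimizes the penalized contrast, uniformly in t ∈ T, in outer probability
    (hmin : TendstoOuterZero P fun n ω =>
      ⨆ t : T, ENNReal.ofReal (max
        ((Mn n ω (βhat n ω t) + (t : ℝ) * J n (βhat n ω t)) - (Mn n ω β + (t : ℝ) * J n β)) 0)) :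
    -- conclusion : sup_{t∈T} d(β̂ₙ(ω,t),β) → 0 in outer probability
    TendstoOuterZero P fun n ω => ⨆ t : T, edist (βhat n ω t) β := by
  intro ε hε
  obtain ⟨c, hc, hsep⟩ := h3 (ε / 2) (half_pos hε)
  have hδ : 0 < c / 4 := by positivity
  obtain ⟨B, hB⟩ := hTcompact.bddAbove
  have hBJ : ∀ᶠ n in atTop, B * J n β < c / 4 := by
    have h := hJβ.const_mul B
    rw [mul_zero] at h
    exact h.eventually_lt_const hδ
  have hlim := ((h1 _ hδ).add (h2 _ hδ)).add (hmin _ hδ)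
  simp only [add_zero] at hlim
  refine tendsto_of_tendsto_of_tendsto_of_le_of_le' tendsto_const_nhds hlim
    (Eventually.of_forall fun _ => zero_le) ?_
  filter_upwards [hBJ] with n hn
  refine (measure_mono fun ω hω => ?_).trans <| (measure_union_le _ _).trans <|
    add_le_add_left (measure_union_le _ _) _
  by_contra hbad
  simp only [Set.mem_union, Set.mem_ofPred_eq, not_or, not_le] at hbad
  obtain ⟨⟨hb1, hb2⟩, hb3⟩ := hbad
  refine (lt_of_le_of_lt (iSup_le fun t : T => ?_)
    ((ENNReal.ofReal_lt_ofReal_iff hε).2 (half_lt_self hε))).not_ge hω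
  rw [edist_dist]
  refine ENNReal.ofReal_le_ofReal (le_of_not_ge fun hfar => ?_)
  have ht : (t : ℝ) * J n β ≤ B * J n β :=
    mul_le_mul_of_nonneg_right (hB t.2) (hJnonneg n β)
  have hpen : 0 ≤ (t : ℝ) * J n (βhat n ω t) := mul_nonneg (hTsub t.2) (hJnonneg n _)
  have hM := lt_of_iSup_ofReal_max_lt hδ hb1 (βhat n ω t)
  have hΛ := lt_of_iSup_ofReal_max_lt hδ hb3 t
  linarith [hsep _ hfar, (abs_lt.1 hb2).2]
end

section
/- Let Φ be a convex subset of ℝ^p and β ∈ Φ such that Φ contains an open Euclidean ball around β. Let M_n : Ω × Φ → ℝ be maps, measurable in ω for each φ, such that for almost every ω the function M_n(ω,·) is convex on Φ. Let V ⊆ Φ contain an open Euclidean ball around β and let Δ : V → ℝ be strictly convex with (i) M_n(φ) → Δ(φ) in probability for every φ ∈ V and (ii) Δ(φ) ≥ Δ(β) for all φ ∈ V. Let J_n : Φ → [0,∞) be functions with J_n(β) → 0, let L ≥ 0, set Λ_n(ω,φ,t) = M_n(ω,φ) + t·J_n(φ), and let β̂_n : Ω × [0,L] → Φ be maps such that sup_{t∈[0,L]}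 max(Λ_n(ω,β̂_n(ω,t),t) − Λ_n(ω,β,t), 0) converges to 0 in outer probability. Then sup_{t∈[0,L]} ‖β̂_n(ω,t) − β‖ converges to 0 in outer probability. -/
open MeasureTheory Filter Topology
open scoped ENNReal

open Metric in
/-- Closeness to a fixed function at finitely many points bounds the Lipschitz constant of a convex
function near a given point. -/
theorem exists_finset_lipschitzOnWith_of_convexOn {E : Type*} [NormedAddCommGroup E]
    [NormedSpace ℝ E] [FiniteDimensional ℝ E] {V : Set E} {x₀ : E} (hV : V ∈ 𝓝 x₀) (g : E → ℝ) :
    ∃ R > 0, ball x₀ R ⊆ V ∧ ∃ T : Finset E, ↑T ⊆ V ∧ ∃ K : NNReal, ∀ f : E → ℝ,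
      ConvexOn ℝ V f → (∀ x ∈ T, |f x - g x| ≤ 1) → LipschitzOnWith K f (ball x₀ R) := by
  classical
  obtain ⟨b, hb, hbV⟩ := exists_mem_interior_convexHull_affineBasis hV
  obtain ⟨r, hr, hrb⟩ := Metric.isOpen_iff.1 isOpen_interior x₀ hb
  replace hrb := hrb.trans interior_subset
  have hbV' : Set.range b ⊆ V := (subset_convexHull ℝ _).trans hbV
  let B : Finset E := Finset.univ.image b
  have hB : (B : Set E) = Set.range b := by simp [B]
  obtain ⟨k, hk⟩ := (B.finite_toSet.image g).bddAbove
  have hkB : ∀ x ∈ B, g x ≤ k := fun x hx => hk ⟨x, hx, rfl⟩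
  set M : ℝ := |k + 1| + 2 * |g x₀ - 1| with hM
  refine ⟨r - r / 2, by linarith, (ball_subset_ball (by linarith)).trans (hrb.trans hbV),
    insert x₀ B, ?_, (2 * M / (r / 2)).toNNReal, fun f hf hfg => ?_⟩
  · rw [Finset.coe_insert, hB]
    exact Set.insert_subset (mem_of_mem_nhds hV) hbV'
  have hup : ∀ a ∈ ball x₀ r, f a ≤ k + 1 := fun a ha => by
    obtain ⟨y, hy, hay⟩ := hf.exists_ge_of_mem_convexHull hbV' (hrb ha)
    have hyB : y ∈ B := by rwa [← Finset.mem_coe, hB]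
    have h₁ := (abs_le.1 (hfg y (Finset.mem_insert_of_mem hyB))).2
    linarith [hkB y hyB]
  refine (hf.subset (hrb.trans hbV) (convex_ball x₀ r)).lipschitzOnWith_of_abs_le (by linarith)
    fun a ha => ?_
  have hreflect : (2 : ℝ) • x₀ - a ∈ ball x₀ r := by
    rw [mem_ball, dist_eq_norm, two_smul]
    rw [dist_comm, dist_eq_norm] at ha
    convert ha using 2
    abel
  have hmid := hf.2 (hbV (hrb (mem_ball.2 ha))) (hbV (hrb hreflect))
    (show (0 : ℝ) ≤ 1 / 2 by norm_num) (show (0 : ℝ) ≤ 1 / 2 by norm_num) (by norm_num)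
  have hx₀ : (1 / 2 : ℝ) • a + (1 / 2 : ℝ) • ((2 : ℝ) • x₀ - a) = x₀ := by module
  rw [hx₀, smul_eq_mul, smul_eq_mul] at hmid
  have h₀ := (abs_le.1 (hfg x₀ (Finset.mem_insert_self _ _))).1
  have h₁ := hup a ha
  have h₂ := hup _ hreflect
  rw [abs_le, hM]
  constructor
  · linarith [le_abs_self (k + 1), neg_abs_le (g x₀ - 1)]
  · linarith [le_abs_self (k + 1), abs_nonneg (g x₀ - 1)]

open Metric in
/-- If `g` is strictly convex with minimizer `x₀`, every convex function which is close to `g` at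
suitable finitely many points is well separated from its value at `x₀` on small spheres. -/
theorem StrictConvexOn.exists_finset_forall_sphere_add_le {E : Type*} [NormedAddCommGroup E]
    [NormedSpace ℝ E] [FiniteDimensional ℝ E] {V : Set E} {x₀ : E} (hV : V ∈ 𝓝 x₀) {g : E → ℝ}
    (hg : StrictConvexOn ℝ V g) (hmin : IsMinOn g V x₀) :
    ∃ R > 0, ∀ r, 0 < r → r < R → ∃ T : Finset E, ↑T ⊆ V ∧ ∃ δ > 0, ∀ f : E → ℝ,
      ConvexOn ℝ V f → (∀ x ∈ T, |f x - g x| < δ) → ∀ x ∈ sphere x₀ r, f x₀ + δ ≤ f x := by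
  classical
  obtain ⟨R, hR, hRV, T, hTV, K, hK⟩ := exists_finset_lipschitzOnWith_of_convexOn hV g
  refine ⟨R, hR, fun r hr hrR => ?_⟩
  have hsR : sphere x₀ r ⊆ ball x₀ R := sphere_subset_closedBall.trans (closedBall_subset_ball hrR)
  have hx₀ := mem_of_mem_nhds hV
  have hcomp : IsCompact (sphere x₀ r) := isCompact_sphere x₀ r
  have hgK : LipschitzOnWith K g (ball x₀ R) := hK g hg.convexOn (by simp)
  obtain ⟨m, hm, hgm⟩ : ∃ m > 0, ∀ x ∈ sphere x₀ r, g x₀ + m ≤ g x := by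
    rcases (sphere x₀ r).eq_empty_or_nonempty with he | hne
    · exact ⟨1, one_pos, by simp [he]⟩
    obtain ⟨y, hy, hymin⟩ := hcomp.exists_isMinOn hne (hgK.continuousOn.mono hsR)
    refine ⟨g y - g x₀, sub_pos.2 (lt_of_not_ge fun hle => ?_), fun x hx => ?_⟩
    · have hyx : y = x₀ := hg.eq_of_isMinOn
        (fun z hz => hle.trans (hmin hz)) hmin (hRV (hsR hy)) hx₀
      rw [hyx, mem_sphere, dist_self] at hy
      exact hr.ne hy
    · have h := isMinOn_iff.1 hymin x hx
      linarith
  set δ : ℝ := min 1 (m / 4) with hδ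
  have hδ0 : 0 < δ := by positivity
  have hδ1 : δ ≤ 1 := min_le_left _ _
  have hδm : δ ≤ m / 4 := min_le_right _ _
  obtain ⟨S, hS, hSfin, hcover⟩ := hcomp.finite_cover_balls (e := δ / (K + 1)) (by positivity)
  lift S to Finset E using hSfin
  refine ⟨insert x₀ (T ∪ S), ?_, δ, hδ0, fun f hf hfg x hx => ?_⟩
  · rw [Finset.coe_insert, Finset.coe_union]
    exact Set.insert_subset hx₀ (Set.union_subset hTV (hS.trans (hsR.trans hRV)))
  have hfK := hK f hf fun y hy => (hfg y (by simp [hy])).le.trans hδ1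
  obtain ⟨y, hyS, hxy⟩ := Set.mem_iUnion₂.1 (hcover hx)
  have hdist := hfK.dist_le_mul x (hsR hx) y (hsR (hS hyS))
  have hKδ : K * dist x y ≤ δ := by
    have h : (K + 1) * dist x y < δ := (lt_div_iff₀' (by positivity)).1 (mem_ball.1 hxy)
    nlinarith [dist_nonneg (x := x) (y := y)]
  rw [Real.dist_eq] at hdist
  have h₁ := (abs_le.1 (hdist.trans hKδ)).1
  have h₂ := (abs_lt.1 (hfg y (by simp [Finset.mem_coe.1 hyS]))).1
  have h₃ := (abs_lt.1 (hfg x₀ (by simp))).2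
  linarith [hgm y (hS hyS)]

/-- A convex function exceeding its value at `x₀` by `δ` on a sphere exceeds it by `δ` outside. -/
theorem ConvexOn.add_le_of_forall_sphere {E : Type*} [NormedAddCommGroup E] [NormedSpace ℝ E]
    {s : Set E} {f : E → ℝ} (hf : ConvexOn ℝ s f) {x₀ x : E} (hx₀ : x₀ ∈ s) (hx : x ∈ s)
    {r δ : ℝ} (hr : 0 < r) (hδ : 0 ≤ δ) (hsphere : ∀ y ∈ Metric.sphere x₀ r, f x₀ + δ ≤ f y)
    (hrx : r ≤ ‖x - x₀‖) : f x₀ + δ ≤ f x := by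
  have hpos : 0 < ‖x - x₀‖ := hr.trans_le hrx
  set c : ℝ := r / ‖x - x₀‖ with hc
  have hc0 : 0 < c := by positivity
  have hc1 : c ≤ 1 := (div_le_one hpos).2 hrx
  have hy : (1 - c) • x₀ + c • x ∈ Metric.sphere x₀ r := by
    have h : (1 - c) • x₀ + c • x - x₀ = c • (x - x₀) := by module
    rw [mem_sphere_iff_norm, h, norm_smul, Real.norm_of_nonneg hc0.le, hc,
      div_mul_cancel₀ _ hpos.ne']
  have h₁ := hf.2 hx₀ hx (sub_nonneg.2 hc1) hc0.le (by ring)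
  have h₂ := hsphere _ hy
  rw [smul_eq_mul, smul_eq_mul] at h₁
  have h₃ : δ ≤ c * (f x - f x₀) := by linarith
  by_contra! hlt
  nlinarith

/-- Uniform consistency of penalized M-estimators under convexity
(Theorem 4(a) of the paper). -/
theorem convex_penalized_uniform_consistency
    {Ω : Type*} [MeasurableSpace Ω] (P : Measure Ω) [IsProbabilityMeasure P]
    {p : ℕ} (Φ : Set (EuclideanSpace ℝ (Fin p))) (hΦconv : Convex ℝ Φ)
    (β : EuclideanSpace ℝ (Fin p)) (hβΦ : ∃ r > 0, Metric.ball β r ⊆ Φ)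
    (Mn : ℕ → Ω → EuclideanSpace ℝ (Fin p) → ℝ)
    (hmeas : ∀ n φ, Measurable fun ω => Mn n ω φ)
    -- for almost every ω, Mₙ(ω,·) is convex on Φ
    (hconv : ∀ n, ∀ᵐ ω ∂P, ConvexOn ℝ Φ (Mn n ω))
    (V : Set (EuclideanSpace ℝ (Fin p))) (hVΦ : V ⊆ Φ)
    (hβV : ∃ r > 0, Metric.ball β r ⊆ V)
    (Δ : EuclideanSpace ℝ (Fin p) → ℝ) (hΔ : StrictConvexOn ℝ V Δ)
    -- (i) Mₙ(φ) → Δ(φ) in probability for every φ ∈ V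
    (hptwise : ∀ φ ∈ V, ∀ ε : ℝ, 0 < ε →
      Tendsto (fun n => P {ω | ε ≤ |Mn n ω φ - Δ φ|}) atTop (𝓝 0))
    -- (ii) Δ(φ) ≥ Δ(β) for all φ ∈ V
    (hΔmin : ∀ φ ∈ V, Δ β ≤ Δ φ)
    -- penalty : nonnegative with Jₙ(β) → 0
    (J : ℕ → EuclideanSpace ℝ (Fin p) → ℝ) (hJnonneg : ∀ n φ, 0 ≤ J n φ)
    (hJβ : Tendsto (fun n => J n β) atTop (𝓝 0))
    (L : ℝ) (hL : 0 ≤ L)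
    (βhat : ℕ → Ω → ℝ → EuclideanSpace ℝ (Fin p))
    (hβhatΦ : ∀ n ω t, t ∈ Set.Icc (0:ℝ) L → βhat n ω t ∈ Φ)
    -- β̂ₙ near-minimizes the penalized contrast Λₙ(ω,φ,t) = Mₙ(ω,φ) + t·Jₙ(φ) on [0,L]
    (hmin : TendstoOuterZero P fun n ω =>
      ⨆ t : Set.Icc (0:ℝ) L, ENNReal.ofReal (max
        ((Mn n ω (βhat n ω t) + (t : ℝ) * J n (βhat n ω t)) - (Mn n ω β + (t : ℝ) * J n β)) 0)) :
    -- conclusion : sup_{t∈[0,L]} ‖β̂ₙ(ω,t) − β‖ → 0 in outer probability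
    TendstoOuterZero P fun n ω =>
      ⨆ t : Set.Icc (0:ℝ) L, ENNReal.ofReal ‖βhat n ω t - β‖ := by
  obtain ⟨r₁, hr₁, hr₁V⟩ := hβV
  have hVnhds : V ∈ 𝓝 β := Filter.mem_of_superset (Metric.ball_mem_nhds β hr₁) hr₁V
  have hβ : β ∈ Φ := hVΦ (mem_of_mem_nhds hVnhds)
  obtain ⟨R, hR, hsep⟩ := hΔ.exists_finset_forall_sphere_add_le hVnhds (isMinOn_iff.2 hΔmin)
  intro ε hε
  set r : ℝ := min ε R / 2 with hr
  have hr0 : 0 < r := by positivity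
  have hrR : r < R := by
    have := min_le_right ε R
    linarith
  have hrε : r < ε := by
    have := min_le_left ε R
    linarith
  obtain ⟨T, hTV, δ, hδ, hT⟩ := hsep r hr0 hrR
  have hLJ : ∀ᶠ n in atTop, L * J n β < δ / 2 := by
    have h := hJβ.const_mul L
    rw [mul_zero] at h
    exact h.eventually_lt_const (by positivity)
  have hlim : Tendsto (fun n => (∑ φ ∈ T, P {ω | δ ≤ |Mn n ω φ - Δ φ|}) +
      P {ω | ENNReal.ofReal (δ / 2) ≤ ⨆ t : Set.Icc (0:ℝ) L, ENNReal.ofReal (max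
        ((Mn n ω (βhat n ω t) + (t : ℝ) * J n (βhat n ω t)) -
          (Mn n ω β + (t : ℝ) * J n β)) 0)}) atTop (𝓝 0) := by
    have h := (tendsto_finsetSum T fun φ hφ => hptwise φ (hTV hφ) δ hδ).add
      (hmin (δ / 2) (by positivity))
    simpa using h
  refine tendsto_of_tendsto_of_tendsto_of_le_of_le' tendsto_const_nhds hlim
    (.of_forall fun _ => zero_le) ?_
  filter_upwards [hLJ] with n hn
  refine le_trans (measure_mono_ae ?_) ((measure_union_le _ _).trans
    (add_le_add_left (measure_biUnion_finset_le T _) _))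
  filter_upwards [hconv n] with ω hω hsup
  by_contra hnot
  obtain ⟨hnotT, hnotsup⟩ := not_or.1 hnot
  apply hnotsup
  change ENNReal.ofReal (δ / 2) ≤ iSup _
  have hclose : ∀ φ ∈ T, |Mn n ω φ - Δ φ| < δ := fun φ hφ =>
    lt_of_not_ge fun h => hnotT (Set.mem_biUnion hφ h)
  have hlt : ENNReal.ofReal r < ⨆ t : Set.Icc (0:ℝ) L, ENNReal.ofReal ‖βhat n ω t - β‖ :=
    ((ENNReal.ofReal_lt_ofReal_iff hε).2 hrε).trans_le hsup
  obtain ⟨t, ht⟩ := lt_iSup_iff.1 hlt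
  have hfar : r < ‖βhat n ω t - β‖ := (ENNReal.ofReal_lt_ofReal_iff_of_nonneg hr0.le).1 ht
  have hgap := hω.add_le_of_forall_sphere hβ (hβhatΦ n ω t t.2) hr0 hδ.le
    (hT _ (hω.subset hVΦ hΔ.1) hclose) hfar.le
  refine le_iSup_of_le t (ENNReal.ofReal_le_ofReal (le_max_of_le_left ?_))
  have h₁ : 0 ≤ (t : ℝ) * J n (βhat n ω t) := mul_nonneg t.2.1 (hJnonneg _ _)
  have h₂ : (t : ℝ) * J n β ≤ L * J n β := mul_le_mul_of_nonneg_right t.2.2 (hJnonneg _ _)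
  linarith
end

section
/- Let Φ be a convex subset of ℝ^p, f : Φ → ℝ a convex function, β ∈ Φ, ε > 0 and c > 0. If f(φ) ≥ f(β) + c for every φ ∈ Φ with ε < ‖φ − β‖ ≤ 2ε, then f(φ) ≥ f(β) + c for every φ ∈ Φ with ‖φ − β‖ > ε. -/
/-- Convexity argument: a lower bound for a convex function on the annulus
`ε < ‖φ − β‖ ≤ 2ε` around `β` extends to the whole complement of the ball of radius `ε`. -/
theorem convex_annulus_lower_bound
    {p : ℕ} {Φ : Set (EuclideanSpace ℝ (Fin p))} (hΦconv : Convex ℝ Φ)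
    {f : EuclideanSpace ℝ (Fin p) → ℝ} (hf : ConvexOn ℝ Φ f)
    {β : EuclideanSpace ℝ (Fin p)} (hβ : β ∈ Φ)
    {ε c : ℝ} (hε : 0 < ε) (hc : 0 < c)
    (h : ∀ φ ∈ Φ, ε < ‖φ - β‖ → ‖φ - β‖ ≤ 2 * ε → f β + c ≤ f φ) :
    ∀ φ ∈ Φ, ε < ‖φ - β‖ → f β + c ≤ f φ := by
  intro φ hφ hεφ
  rcases le_or_gt ‖φ - β‖ (2 * ε) with hle | hlt
  · exact h φ hφ hεφ hle
  have hr : 0 < ‖φ - β‖ := hε.trans hεφ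
  obtain ⟨t, ht⟩ : ∃ t, t = 2 * ε / ‖φ - β‖ := ⟨_, rfl⟩
  have ht0 : 0 < t := by rw [ht]; positivity
  have ht1 : t < 1 := by rwa [ht, div_lt_one hr]
  have hnorm : ‖((1 - t) • β + t • φ) - β‖ = 2 * ε := by
    have hsub : ((1 - t) • β + t • φ) - β = t • (φ - β) := by module
    rw [hsub, norm_smul, Real.norm_of_nonneg ht0.le, ht, div_mul_cancel₀ _ hr.ne']
  have hmem : (1 - t) • β + t • φ ∈ Φ :=
    hΦconv hβ hφ (by linarith) ht0.le (by ring)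
  have hlower := h _ hmem (by linarith) hnorm.le
  have hupper := hf.2 hβ hφ (by linarith : 0 ≤ 1 - t) ht0.le (by ring)
  simp only [smul_eq_mul] at hupper
  have hgap : c ≤ t * (f φ - f β) := by linarith
  have hpos : 0 < f φ - f β := pos_of_mul_pos_right (hc.trans_le hgap) ht0.le
  linarith [mul_le_of_le_one_left hpos.le ht1.le]
end

section
/- Fix γ > 0 and β ∈ ℝ^p, and define J_n^{(γ)}(φ) = n^{(min(1,γ))/2 − 1} Σ_{k=1}^p |φ_k|^γ for φ ∈ ℝ^p and integers n ≥ 1. Then there exists a constant C > 0 such that for all n ≥ 1 and all φ ∈ ℝ^p, n·|J_n^{(γ)}(φ) − J_n^{(γ)}(β)| ≤ C·(1 + √n·‖φ − β‖ + √n·‖φ − β‖^{max(1,γ)}). -/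
/-- The normalized `ℓ^γ` penalty `J_n^{(γ)}(φ) = n^{(min(1,γ))/2 − 1} Σ_k |φ_k|^γ`. -/
noncomputable def Jpen {p : ℕ} (γ : ℝ) (n : ℕ) (φ : EuclideanSpace ℝ (Fin p)) : ℝ :=
  (n : ℝ) ^ (min 1 γ / 2 - 1) * ∑ k, |φ k| ^ γ

/-- For `0 < γ ≤ 1`, the map `x ↦ |x| ^ γ` is `γ`-Hölder with constant one. -/
theorem abs_abs_rpow_sub_abs_rpow_le {γ : ℝ} (hγ : 0 < γ) (hγ1 : γ ≤ 1) (x b : ℝ) :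
    |(|x| ^ γ - |b| ^ γ)| ≤ |x - b| ^ γ := by
  have key (u v : ℝ) : |u| ^ γ ≤ |v| ^ γ + |u - v| ^ γ :=
    calc |u| ^ γ ≤ (|v| + |u - v|) ^ γ := by
          refine Real.rpow_le_rpow (abs_nonneg _) ?_ hγ.le
          simpa using abs_add_le v (u - v)
      _ ≤ |v| ^ γ + |u - v| ^ γ :=
          Real.rpow_add_le_add_rpow (abs_nonneg _) (abs_nonneg _) hγ.le hγ1
  have h1 := key x b
  have h2 := key b x
  rw [abs_sub_comm b x] at h2
  exact abs_le.2 ⟨by linarith, by linarith⟩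

/-- For `1 ≤ γ`, the map `x ↦ x ^ γ` is Lipschitz on `[0, M]` with constant `γ * M ^ (γ - 1)`. -/
theorem abs_rpow_sub_rpow_le_of_le {γ M a b : ℝ} (hγ : 1 ≤ γ) (ha : 0 ≤ a) (haM : a ≤ M)
    (hb : 0 ≤ b) (hbM : b ≤ M) :
    |a ^ γ - b ^ γ| ≤ γ * M ^ (γ - 1) * |a - b| := by
  refine (convex_Icc 0 M).norm_image_sub_le_of_norm_hasDerivWithin_le
    (f := fun x : ℝ => x ^ γ) (f' := fun x => γ * x ^ (γ - 1))
    (fun x _ => (Real.hasDerivAt_rpow_const (Or.inr hγ)).hasDerivWithinAt)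
    (fun x hx => ?_) ⟨hb, hbM⟩ ⟨ha, haM⟩
  rw [Real.norm_of_nonneg (mul_nonneg (by linarith) (Real.rpow_nonneg hx.1 _))]
  exact mul_le_mul_of_nonneg_left (Real.rpow_le_rpow hx.1 hx.2 (by linarith)) (by linarith)

/-- For `1 ≤ γ`, the increments of `x ↦ |x| ^ γ` at a fixed point grow at most like
`t + t ^ γ`. -/
theorem exists_abs_abs_rpow_sub_abs_rpow_le {γ : ℝ} (hγ : 1 ≤ γ) (b : ℝ) :
    ∃ C : ℝ, 0 ≤ C ∧ ∀ x : ℝ, |(|x| ^ γ - |b| ^ γ)| ≤ C * (|x - b| + |x - b| ^ γ) := by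
  have hγ0 : 0 ≤ γ := by linarith
  have hγ1 : 0 ≤ γ - 1 := by linarith
  have hA : 0 ≤ (2 * |b|) ^ (γ - 1) := by positivity
  have hB : 0 ≤ (2 : ℝ) ^ (γ - 1) := by positivity
  refine ⟨γ * ((2 * |b|) ^ (γ - 1) + 2 ^ (γ - 1)), by positivity, fun x => ?_⟩
  have ht := abs_nonneg (x - b)
  have hb := abs_nonneg b
  have hx : |x| ≤ |b| + |x - b| := by simpa using abs_add_le b (x - b)
  have hLip := abs_rpow_sub_rpow_le_of_le hγ (abs_nonneg x) hx hb (by linarith)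
  have hdiff : |(|x| - |b|)| ≤ |x - b| := abs_abs_sub_abs_le_abs_sub x b
  generalize |x - b| = t at *
  have hM : (|b| + t) ^ (γ - 1) ≤ (2 * |b|) ^ (γ - 1) + 2 ^ (γ - 1) * t ^ (γ - 1) := by
    rw [← Real.mul_rpow zero_le_two ht]
    rcases le_total t |b| with h | h
    · exact (Real.rpow_le_rpow (by positivity) (by linarith) hγ1).trans
        (le_add_of_nonneg_right (by positivity))
    · exact (Real.rpow_le_rpow (by positivity) (by linarith) hγ1).trans
        (le_add_of_nonneg_left (by positivity))
  have hpow : t ^ (γ - 1) * t = t ^ γ := by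
    rw [← Real.rpow_add_one' ht (by linarith), sub_add_cancel]
  have htγ : 0 ≤ t ^ γ := by positivity
  calc |(|x| ^ γ - |b| ^ γ)| ≤ γ * (|b| + t) ^ (γ - 1) * |(|x| - |b|)| := hLip
    _ ≤ γ * ((2 * |b|) ^ (γ - 1) + 2 ^ (γ - 1) * t ^ (γ - 1)) * t := by gcongr
    _ = γ * ((2 * |b|) ^ (γ - 1) * t + 2 ^ (γ - 1) * t ^ γ) := by rw [← hpow]; ring
    _ ≤ γ * ((2 * |b|) ^ (γ - 1) + 2 ^ (γ - 1)) * (t + t ^ γ) := by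
        rw [mul_assoc]
        refine mul_le_mul_of_nonneg_left ?_ hγ0
        nlinarith [mul_nonneg hA htγ, mul_nonneg hB ht]

/-- The one-dimensional version of `Jpen_bound`. -/
theorem exists_rpow_mul_abs_abs_rpow_sub_le {γ : ℝ} (hγ : 0 < γ) (b : ℝ) :
    ∃ C : ℝ, 0 ≤ C ∧ ∀ n : ℕ, ∀ x : ℝ,
      (n : ℝ) ^ (min 1 γ / 2) * |(|x| ^ γ - |b| ^ γ)| ≤
        C * (1 + Real.sqrt n * |x - b| + Real.sqrt n * |x - b| ^ (max 1 γ)) := by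
  rcases le_total γ 1 with h | h
  · refine ⟨1, zero_le_one, fun n x => ?_⟩
    rw [min_eq_right h, max_eq_left h, Real.rpow_one]
    have hs : 0 ≤ Real.sqrt n * |x - b| := by positivity
    have hpow : (Real.sqrt n * |x - b|) ^ γ ≤ 1 + Real.sqrt n * |x - b| := by
      rcases le_total (Real.sqrt n * |x - b|) 1 with h1 | h1
      · linarith [Real.rpow_le_one hs h1 hγ.le]
      · linarith [Real.rpow_le_self_of_one_le h1 h]
    calc (n : ℝ) ^ (γ / 2) * |(|x| ^ γ - |b| ^ γ)| ≤ (n : ℝ) ^ (γ / 2) * |x - b| ^ γ := by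
          gcongr
          exact abs_abs_rpow_sub_abs_rpow_le hγ h x b
      _ = (Real.sqrt n * |x - b|) ^ γ := by
          rw [Real.mul_rpow (Real.sqrt_nonneg _) (abs_nonneg _), Real.sqrt_eq_rpow,
            ← Real.rpow_mul (Nat.cast_nonneg n)]
          ring_nf
      _ ≤ 1 * (1 + Real.sqrt n * |x - b| + Real.sqrt n * |x - b|) := by linarith
  · obtain ⟨C, hC, hbound⟩ := exists_abs_abs_rpow_sub_abs_rpow_le h b
    refine ⟨C, hC, fun n x => ?_⟩
    rw [min_eq_left h, max_eq_right h, ← Real.sqrt_eq_rpow]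
    have := mul_le_mul_of_nonneg_left (hbound x) (Real.sqrt_nonneg n)
    linarith

/-- Bound on the normalized `ℓ^γ` penalty (Eq. (18) of Lemma 1 of the paper):
`n·|J_n^{(γ)}(φ) − J_n^{(γ)}(β)| ≤ C·(1 + √n‖φ−β‖ + √n‖φ−β‖^{max(1,γ)})`. -/
theorem Jpen_bound {p : ℕ} (γ : ℝ) (hγ : 0 < γ) (β : EuclideanSpace ℝ (Fin p)) :
    ∃ C : ℝ, 0 < C ∧ ∀ n : ℕ, 1 ≤ n → ∀ φ : EuclideanSpace ℝ (Fin p),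
      (n : ℝ) * |Jpen γ n φ - Jpen γ n β| ≤
        C * (1 + Real.sqrt n * ‖φ - β‖ + Real.sqrt n * ‖φ - β‖ ^ (max 1 γ)) := by
  choose C hC hbound using fun k => exists_rpow_mul_abs_abs_rpow_sub_le hγ (β k)
  have hsum : 0 ≤ ∑ k, C k := Finset.sum_nonneg fun k _ => hC k
  refine ⟨∑ k, C k + 1, by linarith, fun n hn φ => ?_⟩
  have hn0 : (0 : ℝ) < n := by exact_mod_cast hn
  set R := 1 + Real.sqrt n * ‖φ - β‖ + Real.sqrt n * ‖φ - β‖ ^ (max 1 γ) with hR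
  have hR0 : 0 ≤ R := by positivity
  have hcoord (k : Fin p) : (n : ℝ) ^ (min 1 γ / 2) * |(|φ k| ^ γ - |β k| ^ γ)| ≤ C k * R := by
    have hk : |φ k - β k| ≤ ‖φ - β‖ := by simpa using PiLp.norm_apply_le (φ - β) k
    refine (hbound k n (φ k)).trans (mul_le_mul_of_nonneg_left ?_ (hC k))
    rw [hR]
    gcongr
  calc (n : ℝ) * |Jpen γ n φ - Jpen γ n β|
      = (n : ℝ) ^ (min 1 γ / 2) * |∑ k, (|φ k| ^ γ - |β k| ^ γ)| := by
        rw [Jpen, Jpen, ← mul_sub, ← Finset.sum_sub_distrib, abs_mul,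
          abs_of_nonneg (Real.rpow_nonneg hn0.le _), ← mul_assoc, mul_comm (n : ℝ),
          ← Real.rpow_add_one hn0.ne', sub_add_cancel]
    _ ≤ (n : ℝ) ^ (min 1 γ / 2) * ∑ k, |(|φ k| ^ γ - |β k| ^ γ)| := by
        gcongr
        exact Finset.abs_sum_le_sum_abs _ _
    _ ≤ ∑ k, C k * R := by
        rw [Finset.mul_sum]
        exact Finset.sum_le_sum fun k _ => hcoord k
    _ ≤ (∑ k, C k + 1) * R := by
        rw [← Finset.sum_mul]
        linarith
end

section
/- Fix 0 < γ < 1 and β ∈ ℝ^p, and define J_n^{(γ)}(φ) = n^{(min(1,γ))/2 − 1} Σ_{k=1}^p |φ_k|^γ. Define J_∞^{(γ)}(φ) = Σ_{j=1}^p |φ_j|^γ·1(β_j = 0). Then for every compact set K ⊆ ℝ^p, sup_{φ∈K} | n·J_n^{(γ)}(β + n^{−1/2}φ) − n·J_n^{(γ)}(β) − J_∞^{(γ)}(φ) | → 0 as n → ∞. -/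
open Filter

theorem Real.abs_rpow_sub_rpow_le_of_le_one {γ x b : ℝ} (hγ0 : 0 ≤ γ) (hγ1 : γ ≤ 1)
    (hx : 0 ≤ x) (hb : 0 < b) : |x ^ γ - b ^ γ| ≤ b ^ (γ - 1) * |x - b| := by
  obtain ⟨t, ht, rfl⟩ : ∃ t, 0 ≤ t ∧ x = b * t := ⟨x / b, by positivity, by field_simp⟩
  have key : |t ^ γ - 1| ≤ |t - 1| := by
    rcases le_total 1 t with h | h
    · rw [abs_of_nonneg (sub_nonneg.2 (Real.one_le_rpow h hγ0)), abs_of_nonneg (sub_nonneg.2 h)]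
      linarith [Real.rpow_le_self_of_one_le h hγ1]
    · rw [abs_of_nonpos (sub_nonpos.2 (Real.rpow_le_one ht h hγ0)),
        abs_of_nonpos (sub_nonpos.2 h)]
      linarith [Real.self_le_rpow_of_le_one ht h hγ1]
  have h1 : (b * t) ^ γ - b ^ γ = b ^ γ * (t ^ γ - 1) := by
    rw [Real.mul_rpow hb.le ht]; ring
  have h2 : b ^ (γ - 1) * |b * t - b| = b ^ γ * |t - 1| := by
    rw [show b * t - b = b * (t - 1) by ring, abs_mul, abs_of_pos hb, ← mul_assoc,
      Real.rpow_sub_one hb.ne', div_mul_cancel₀ _ hb.ne']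
  rw [h1, h2, abs_mul, abs_of_pos (Real.rpow_pos_of_pos hb γ)]
  gcongr

theorem abs_rescaled_rpow_increment_sub_limit_le {γ x b v : ℝ} (hγ0 : 0 < γ) (hγ1 : γ ≤ 1)
    (hx : 0 < x) :
    |x ^ (γ / 2) * (|b + x ^ (-(1/2) : ℝ) * v| ^ γ - |b| ^ γ) - (if b = 0 then |v| ^ γ else 0)|
      ≤ |b| ^ (γ - 1) * |v| * x ^ (-((1 - γ) / 2)) := by
  have hpos : 0 < x ^ (-(1/2) : ℝ) := Real.rpow_pos_of_pos hx _
  by_cases hb : b = 0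
  · have h : x ^ (γ / 2) * (x ^ (-(1/2) : ℝ)) ^ γ = 1 := by
      rw [← Real.rpow_mul hx.le, ← Real.rpow_add hx]
      ring_nf
      exact Real.rpow_zero x
    have h0 : x ^ (γ / 2) * (|b + x ^ (-(1/2) : ℝ) * v| ^ γ - |b| ^ γ)
        - (if b = 0 then |v| ^ γ else 0) = 0 := by
      rw [if_pos hb, hb, zero_add, abs_mul, abs_of_pos hpos,
        Real.mul_rpow hpos.le (abs_nonneg v), abs_zero, Real.zero_rpow hγ0.ne', sub_zero,
        ← mul_assoc, h, one_mul, sub_self]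
    rw [h0, abs_zero]
    positivity
  · rw [if_neg hb, sub_zero, abs_mul, abs_of_pos (Real.rpow_pos_of_pos hx _)]
    have h1 : |(|b + x ^ (-(1/2) : ℝ) * v|) - (|b|)| ≤ x ^ (-(1/2) : ℝ) * |v| := by
      refine (abs_abs_sub_abs_le_abs_sub _ _).trans_eq ?_
      rw [add_sub_cancel_left, abs_mul, abs_of_pos hpos]
    calc x ^ (γ / 2) * |(|b + x ^ (-(1/2) : ℝ) * v|) ^ γ - (|b|) ^ γ|
        ≤ x ^ (γ / 2) * (|b| ^ (γ - 1) * (x ^ (-(1/2) : ℝ) * |v|)) := by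
          gcongr
          exact (Real.abs_rpow_sub_rpow_le_of_le_one hγ0.le hγ1 (abs_nonneg _)
            (abs_pos.2 hb)).trans (by gcongr)
      _ = |b| ^ (γ - 1) * |v| * (x ^ (γ / 2) * x ^ (-(1/2) : ℝ)) := by ring
      _ = |b| ^ (γ - 1) * |v| * x ^ (-((1 - γ) / 2)) := by
          rw [← Real.rpow_add hx]
          ring_nf

theorem natCast_mul_Jpen {p : ℕ} {γ : ℝ} (hγ1 : γ ≤ 1) {n : ℕ} (hn : 0 < n)
    (φ : EuclideanSpace ℝ (Fin p)) :
    (n : ℝ) * Jpen γ n φ = (n : ℝ) ^ (γ / 2) * ∑ k, |φ k| ^ γ := by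
  have hn0 : (n : ℝ) ≠ 0 := Nat.cast_ne_zero.2 hn.ne'
  rw [Jpen, min_eq_right hγ1, ← mul_assoc, Real.rpow_sub_one hn0,
    mul_div_cancel₀ _ hn0]

/-- Limit of the rescaled `ℓ^γ` penalty for `0 < γ < 1` (Lemma 1 of the paper):
`sup_{φ∈K} |n·J_n^{(γ)}(β + n^{−1/2}φ) − n·J_n^{(γ)}(β) − J_∞^{(γ)}(φ)| → 0`
for every compact `K`, where `J_∞^{(γ)}(φ) = Σ_j |φ_j|^γ 1(β_j = 0)`. -/
theorem Jpen_rescaled_tendstoUniformlyOn_of_lt_one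
    {p : ℕ} (γ : ℝ) (hγ0 : 0 < γ) (hγ1 : γ < 1) (β : EuclideanSpace ℝ (Fin p))
    (K : Set (EuclideanSpace ℝ (Fin p))) (hK : IsCompact K) :
    TendstoUniformlyOn
      (fun (n : ℕ) (φ : EuclideanSpace ℝ (Fin p)) =>
        (n : ℝ) * Jpen γ n (β + ((n : ℝ) ^ (-(1/2) : ℝ)) • φ) - (n : ℝ) * Jpen γ n β)
      (fun φ => ∑ j, if β j = 0 then |φ j| ^ γ else 0)
      atTop K := by
  obtain ⟨R, hR⟩ := hK.isBounded.exists_norm_le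
  have hlim : Tendsto (fun n : ℕ => (∑ j, |β j| ^ (γ - 1) * R) * (n : ℝ) ^ (-((1 - γ) / 2)))
      atTop (nhds 0) := by
    simpa using ((tendsto_rpow_neg_atTop (by linarith : 0 < (1 - γ) / 2)).comp
      tendsto_natCast_atTop_atTop).const_mul (∑ j, |β j| ^ (γ - 1) * R)
  rw [Metric.tendstoUniformlyOn_iff]
  intro ε hε
  filter_upwards [hlim.eventually_lt_const hε, eventually_gt_atTop 0] with n hnε hn φ hφ
  refine lt_of_le_of_lt ?_ hnε
  rw [dist_comm, Real.dist_eq, natCast_mul_Jpen hγ1.le hn, natCast_mul_Jpen hγ1.le hn, ← mul_sub,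
    ← Finset.sum_sub_distrib, Finset.mul_sum, ← Finset.sum_sub_distrib, Finset.sum_mul]
  refine (Finset.abs_sum_le_sum_abs _ _).trans (Finset.sum_le_sum fun j _ => ?_)
  refine (abs_rescaled_rpow_increment_sub_limit_le hγ0 hγ1.le (Nat.cast_pos.2 hn)).trans ?_
  have hφj : |φ j| ≤ R := (PiLp.norm_apply_le φ j).trans (hR φ hφ)
  exact mul_le_mul_of_nonneg_right (mul_le_mul_of_nonneg_left hφj (by positivity)) (by positivity)
end

section
/- Fix β ∈ ℝ^p and define J_n^{(1)}(φ) = n^{−1/2} Σ_{k=1}^p |φ_k|. Define J_∞^{(1)}(φ) = Σ_{j=1}^p [ φ_j·sgn(β_j)·1(β_j ≠ 0) + |φ_j|·1(β_j = 0) ]. Then for every compact set K ⊆ ℝ^p, sup_{φ∈K} | n·J_n^{(1)}(β + n^{−1/2}φ) − n·J_n^{(1)}(β) − J_∞^{(1)}(φ) | → 0 as n → ∞. -/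
open Filter

/-- The normalized `ℓ¹` penalty `J_n^{(1)}(φ) = n^{−1/2} Σ_k |φ_k|`. -/
noncomputable def Jpen1 {p : ℕ} (n : ℕ) (φ : EuclideanSpace ℝ (Fin p)) : ℝ :=
  (n : ℝ) ^ (-(1/2) : ℝ) * ∑ k, |φ k|

/-- The exact first-order expansion of the absolute value at scale `a = s⁻¹`, valid as soon as the
increment `a * x` does not change the sign of a nonzero base point `b`. -/
lemma mul_abs_add_sub_mul_abs {a s b x : ℝ} (ha : 0 < a) (hsa : s * a = 1)
    (hb : b ≠ 0 → a * |x| ≤ |b|) :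
    s * |b + a * x| - s * |b| =
      (if b ≠ 0 then x * Real.sign b else 0) + (if b = 0 then |x| else 0) := by
  rcases lt_trichotomy b 0 with h | rfl | h
  · have hx := hb h.ne
    rw [abs_of_neg h] at hx
    have hle : b + a * x ≤ 0 := by nlinarith [le_abs_self x]
    simp only [h.ne, ne_eq, not_false_eq_true, if_true, if_false, Real.sign_of_neg h,
      abs_of_neg h, abs_of_nonpos hle]
    linear_combination -x * hsa
  · simp only [ne_eq, not_true_eq_false, if_true, if_false, zero_add, abs_mul, abs_of_pos ha,
      abs_zero]
    linear_combination |x| * hsa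
  · have hx := hb h.ne'
    rw [abs_of_pos h] at hx
    have hle : 0 ≤ b + a * x := by nlinarith [neg_abs_le x]
    simp only [h.ne', ne_eq, not_false_eq_true, if_true, if_false, Real.sign_of_pos h,
      abs_of_pos h, abs_of_nonneg hle]
    linear_combination x * hsa

/-- A sequence tending to zero is, after scaling, eventually below all nonzero `|β j|`. -/
lemma eventually_forall_mul_le_abs {ι : Type*} [Finite ι] {u : ℕ → ℝ}
    (hu : Tendsto u atTop (nhds 0)) (C : ℝ) (β : ι → ℝ) :
    ∀ᶠ n in atTop, ∀ j, β j ≠ 0 → u n * C ≤ |β j| := by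
  refine eventually_all.2 fun j => ?_
  by_cases h : β j = 0
  · simp [h]
  · have hlim : Tendsto (fun n => u n * C) atTop (nhds 0) := by simpa using hu.mul_const C
    filter_upwards [hlim.eventually_le_const (abs_pos.2 h)] with n hn _ using hn

/-- Limit of the rescaled `ℓ¹` penalty (Lemma 1 of the paper, case `γ = 1`):
`sup_{φ∈K} |n·J_n^{(1)}(β + n^{−1/2}φ) − n·J_n^{(1)}(β) − J_∞^{(1)}(φ)| → 0` for every
compact `K`, where `J_∞^{(1)}(φ) = Σ_j [φ_j sgn(β_j) 1(β_j ≠ 0) + |φ_j| 1(β_j = 0)]`. -/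
theorem Jpen1_rescaled_tendstoUniformlyOn
    {p : ℕ} (β : EuclideanSpace ℝ (Fin p))
    (K : Set (EuclideanSpace ℝ (Fin p))) (hK : IsCompact K) :
    TendstoUniformlyOn
      (fun (n : ℕ) (φ : EuclideanSpace ℝ (Fin p)) =>
        (n : ℝ) * Jpen1 n (β + ((n : ℝ) ^ (-(1/2) : ℝ)) • φ) - (n : ℝ) * Jpen1 n β)
      (fun φ => ∑ j, ((if β j ≠ 0 then φ j * Real.sign (β j) else 0)
        + (if β j = 0 then |φ j| else 0)))
      atTop K := by
  obtain ⟨C, hC⟩ := hK.isBounded.exists_norm_le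
  have hu : Tendsto (fun n : ℕ => (n : ℝ) ^ (-(1/2) : ℝ)) atTop (nhds 0) :=
    (tendsto_rpow_neg_atTop (by norm_num)).comp tendsto_natCast_atTop_atTop
  refine Metric.tendstoUniformlyOn_iff.2 fun ε hε => ?_
  filter_upwards [eventually_forall_mul_le_abs hu C β, eventually_gt_atTop 0] with n hn hpos φ hφ
  have hn0 : (0 : ℝ) < n := Nat.cast_pos.2 hpos
  have ha : 0 < (n : ℝ) ^ (-(1/2) : ℝ) := Real.rpow_pos_of_pos hn0 _
  have hsa : ((n : ℝ) * (n : ℝ) ^ (-(1/2) : ℝ)) * (n : ℝ) ^ (-(1/2) : ℝ) = 1 := by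
    rw [mul_assoc, ← Real.rpow_add hn0]
    norm_num [Real.rpow_neg_one, hn0.ne']
  convert hε
  rw [dist_eq_zero, Jpen1, Jpen1, ← mul_assoc, ← mul_assoc, Finset.mul_sum, Finset.mul_sum,
    ← Finset.sum_sub_distrib]
  refine Finset.sum_congr rfl fun j _ => ?_
  refine (mul_abs_add_sub_mul_abs ha hsa fun hj => (?_ : _ ≤ _).trans (hn j hj)).symm
  exact mul_le_mul_of_nonneg_left ((PiLp.norm_apply_le φ j).trans (hC φ hφ)) ha.le
end

section
/- Fix γ > 1 and β ∈ ℝ^p, and define J_n^{(γ)}(φ) = n^{−1/2} Σ_{k=1}^p |φ_k|^γ. Define J_∞^{(γ)}(φ) = γ Σ_{j=1}^p φ_j·sgn(β_j)·|β_j|^{γ−1}·1(β_j ≠ 0). Then for every compact set K ⊆ ℝ^p, sup_{φ∈K} | n·J_n^{(γ)}(β + n^{−1/2}φ) − n·J_n^{(γ)}(β) − J_∞^{(γ)}(φ) | → 0 as n → ∞. -/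
open Filter

/-- The normalized `ℓ^γ` penalty for `γ > 1`: `J_n^{(γ)}(φ) = n^{−1/2} Σ_k |φ_k|^γ`. -/
noncomputable def JpenGt {p : ℕ} (γ : ℝ) (n : ℕ) (φ : EuclideanSpace ℝ (Fin p)) : ℝ :=
  (n : ℝ) ^ (-(1/2) : ℝ) * ∑ k, |φ k| ^ γ

/-- Difference quotients of a differentiable map along steps shrinking to `0` converge to the
derivative, uniformly over bounded sets of directions. -/
theorem HasFDerivAt.tendstoUniformlyOn_inv_smul_sub {𝕜 E F ι : Type*}
    [NontriviallyNormedField 𝕜] [NormedAddCommGroup E] [NormedSpace 𝕜 E]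
    [NormedAddCommGroup F] [NormedSpace 𝕜 F] {f : E → F} {f' : E →L[𝕜] F} {x : E}
    (hf : HasFDerivAt f f' x) {l : Filter ι} {h : ι → 𝕜} (hh : Tendsto h l (nhdsWithin 0 {0}ᶜ))
    {s : Set E} (hs : Bornology.IsBounded s) :
    TendstoUniformlyOn (fun i v => (h i)⁻¹ • (f (x + h i • v) - f x)) f' l s := by
  obtain ⟨R, hR, hsR⟩ := hs.exists_pos_norm_le
  rw [Metric.tendstoUniformlyOn_iff]
  intro ε hε
  have hsmall := (hasFDerivAt_iff_isLittleO_nhds_zero.1 hf).def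
    (show 0 < ε / (2 * R) by positivity)
  obtain ⟨δ, hδ, hball⟩ := Metric.eventually_nhds_iff.1 hsmall
  have hh0 : Tendsto h l (nhds 0) := hh.mono_right nhdsWithin_le_nhds
  have hstep : ∀ᶠ i in l, ‖h i‖ < δ / R := by
    simpa using Metric.tendsto_nhds.1 hh0 (δ / R) (by positivity)
  filter_upwards [hstep, hh.eventually self_mem_nhdsWithin] with i hi hne v hv
  have hpos : 0 < ‖h i‖ := norm_pos_iff.2 hne
  have hnorm : ‖h i • v‖ ≤ ‖h i‖ * R := by
    rw [norm_smul]
    gcongr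
    exact hsR v hv
  have hbound := hball (y := h i • v) (by
    rw [dist_zero_right]
    exact hnorm.trans_lt ((lt_div_iff₀ hR).1 hi))
  have hquot : (h i)⁻¹ • (f (x + h i • v) - f x) - f' v
      = (h i)⁻¹ • (f (x + h i • v) - f x - f' (h i • v)) := by
    rw [map_smul, smul_sub _ _ (h i • f' v), inv_smul_smul₀ hne]
  rw [dist_comm, dist_eq_norm, hquot, norm_smul, norm_inv]
  calc ‖h i‖⁻¹ * ‖f (x + h i • v) - f x - f' (h i • v)‖
      ≤ ‖h i‖⁻¹ * (ε / (2 * R) * (‖h i‖ * R)) := by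
        gcongr
        exact hbound.trans (by gcongr)
    _ = ε / 2 := by field_simp
    _ < ε := half_lt_self hε

theorem Real.abs_rpow_sub_two_mul_self {x : ℝ} (hx : x ≠ 0) (r : ℝ) :
    |x| ^ (r - 2) * x = Real.sign x * |x| ^ (r - 1) := by
  have hpow : |x| ^ (r - 1) = |x| ^ (r - 2) * |x| := by
    rw [← Real.rpow_add_one (abs_ne_zero.2 hx)]
    ring_nf
  rw [hpow]
  rcases hx.lt_or_gt with hneg | hpos
  · rw [Real.sign_of_neg hneg, abs_of_neg hneg]
    ring
  · rw [Real.sign_of_pos hpos, abs_of_pos hpos]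
    ring

theorem EuclideanSpace.hasFDerivAt_sum_abs_rpow {ι : Type*} [Fintype ι] {γ : ℝ} (hγ : 1 < γ)
    (β : EuclideanSpace ℝ ι) :
    HasFDerivAt (fun φ : EuclideanSpace ℝ ι => ∑ k, |φ k| ^ γ)
      (∑ k, (γ * |β k| ^ (γ - 2) * β k) • (EuclideanSpace.proj k : StrongDual ℝ _)) β :=
  HasFDerivAt.fun_sum fun k _ =>
    HasDerivAt.comp_hasFDerivAt (h₂ := fun y : ℝ => |y| ^ γ) β (hasDerivAt_abs_rpow (β k) hγ)
      (EuclideanSpace.proj k : StrongDual ℝ (EuclideanSpace ℝ ι)).hasFDerivAt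

/-- Limit of the rescaled `ℓ^γ` penalty for `γ > 1` (Lemma 1 of the paper):
`sup_{φ∈K} |n·J_n^{(γ)}(β + n^{−1/2}φ) − n·J_n^{(γ)}(β) − J_∞^{(γ)}(φ)| → 0` for every
compact `K`, where `J_∞^{(γ)}(φ) = γ Σ_j φ_j sgn(β_j) |β_j|^{γ−1} 1(β_j ≠ 0)`. -/
theorem JpenGt_rescaled_tendstoUniformlyOn
    {p : ℕ} (γ : ℝ) (hγ : 1 < γ) (β : EuclideanSpace ℝ (Fin p))
    (K : Set (EuclideanSpace ℝ (Fin p))) (hK : IsCompact K) :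
    TendstoUniformlyOn
      (fun (n : ℕ) (φ : EuclideanSpace ℝ (Fin p)) =>
        (n : ℝ) * JpenGt γ n (β + ((n : ℝ) ^ (-(1/2) : ℝ)) • φ) - (n : ℝ) * JpenGt γ n β)
      (fun φ => γ * ∑ j, if β j ≠ 0 then φ j * Real.sign (β j) * |β j| ^ (γ - 1) else 0)
      atTop K := by
  have hstep : Tendsto (fun n : ℕ => (n : ℝ) ^ (-(1/2) : ℝ)) atTop (nhdsWithin 0 {0}ᶜ) := by
    refine tendsto_nhdsWithin_iff.2
      ⟨(tendsto_rpow_neg_atTop one_half_pos).comp tendsto_natCast_atTop_atTop, ?_⟩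
    filter_upwards [eventually_gt_atTop 0] with n hn
    exact (Real.rpow_pos_of_pos (Nat.cast_pos.2 hn) _).ne'
  have hlim := (EuclideanSpace.hasFDerivAt_sum_abs_rpow hγ β).tendstoUniformlyOn_inv_smul_sub
    hstep hK.isBounded
  refine (hlim.congr ?_).congr_right ?_
  · filter_upwards [eventually_gt_atTop 0] with n hn φ _
    have hn' : (0 : ℝ) < n := Nat.cast_pos.2 hn
    have hscale : ((n : ℝ) ^ (-(1/2) : ℝ))⁻¹ = n * (n : ℝ) ^ (-(1/2) : ℝ) := by
      rw [← Real.rpow_neg hn'.le, mul_comm, ← Real.rpow_add_one hn'.ne']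
      norm_num
    simp only [JpenGt, hscale, smul_eq_mul]
    ring
  · intro φ _
    simp only [sum_apply, smul_apply, EuclideanSpace.proj,
      PiLp.proj_apply, smul_eq_mul, Finset.mul_sum]
    refine Finset.sum_congr rfl fun k _ => ?_
    split_ifs with hk
    · rw [mul_assoc γ, Real.abs_rpow_sub_two_mul_self hk]
      ring
    · simp [not_not.1 hk]
end

section
/- Let x be a random vector in ℝ^p with E‖x‖² < ∞ and let ε be a real random variable independent of x, with E|ε| < ∞ and with a bounded continuous density f whose cumulative distribution function F satisfies F(0) = 1/2. Fix β ∈ ℝ^p and define G(φ) = E|ε + xᵀ(β − φ)| for φ ∈ ℝ^p. Then G has the second-order expansion G(β + δ) = G(β) + f(0)·δᵀE[x xᵀ]δ + o(‖δ‖²) as δ → 0; that is, G has first derivative 0 and second derivative Γ = 2 f(0)·E[x xᵀ] at β. -/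
open MeasureTheory Asymptotics ProbabilityTheory
open scoped RealInnerProductSpace Topology

/-- The limit contrast of the LAD criterion: `G(φ) = E|ε + xᵀ(β − φ)|`. -/
noncomputable def ladLimitContrast {Ω : Type*} [MeasurableSpace Ω] (P : Measure Ω)
    {p : ℕ} (X : Ω → EuclideanSpace ℝ (Fin p)) (e : Ω → ℝ)
    (β φ : EuclideanSpace ℝ (Fin p)) : ℝ :=
  ∫ ω, |e ω + ⟪X ω, β - φ⟫| ∂P

/-- The averaged density `∫₀¹ 2(1 - t) f(ut) dt`: for a centred law with density `f`, the increment
`E|ε - u| - E|ε|` equals `u²` times it. -/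
noncomputable def averagedDensity (f : ℝ → ℝ) (u : ℝ) : ℝ :=
  ∫ t in (0 : ℝ)..1, 2 * (1 - t) * f (u * t)

theorem continuous_averagedDensity {f : ℝ → ℝ} (hf : Continuous f) :
    Continuous (averagedDensity f) := by
  unfold averagedDensity
  exact intervalIntegral.continuous_parametric_intervalIntegral_of_continuous'
    (f := fun u t : ℝ => 2 * (1 - t) * f (u * t)) (by fun_prop) 0 1

theorem averagedDensity_zero (f : ℝ → ℝ) : averagedDensity f 0 = f 0 := by
  simp only [averagedDensity, zero_mul]
  rw [intervalIntegral.integral_mul_const, intervalIntegral.integral_const_mul,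
    intervalIntegral.integral_sub (by simp) (by simp)]
  norm_num

theorem abs_averagedDensity_le {f : ℝ → ℝ} (hf : ∀ s, 0 ≤ f s) {M : ℝ} (hM : ∀ s, f s ≤ M)
    (u : ℝ) : |averagedDensity f u| ≤ 2 * M := by
  have h := intervalIntegral.norm_integral_le_of_norm_le_const (a := (0 : ℝ)) (b := 1)
    (f := fun t => 2 * (1 - t) * f (u * t)) (C := 2 * M) (by
      intro t ht
      rw [Set.uIoc_of_le zero_le_one] at ht
      have h1 : 0 ≤ 1 - t := by linarith [ht.2]
      rw [Real.norm_of_nonneg (mul_nonneg (by linarith) (hf _))]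
      exact mul_le_mul (by linarith [ht.1]) (hM _) (hf _) zero_le_two)
  simpa [averagedDensity] using h

theorem sq_mul_averagedDensity (f : ℝ → ℝ) (u : ℝ) :
    u ^ 2 * averagedDensity f u = ∫ s in (0 : ℝ)..u, 2 * (u - s) * f s := by
  have h := intervalIntegral.smul_integral_comp_mul_left (a := 0) (b := 1)
    (fun s => 2 * (u - s) * f s) u
  rw [mul_zero, mul_one] at h
  rw [← h, averagedDensity, smul_eq_mul, pow_two, mul_assoc,
    ← intervalIntegral.integral_const_mul]
  congr 2 with t
  ring

theorem setIntegral_withDensity_ofReal {f : ℝ → ℝ} (hf : Continuous f) (hf0 : ∀ s, 0 ≤ f s)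
    {S : Set ℝ} (hS : MeasurableSet S) (g : ℝ → ℝ) :
    ∫ s in S, g s ∂(volume.withDensity fun s => ENNReal.ofReal (f s)) = ∫ s in S, g s * f s := by
  rw [setIntegral_withDensity_eq_setIntegral_toReal_smul (by fun_prop) (by simp) _ hS]
  simp [ENNReal.toReal_ofReal (hf0 _), mul_comm]

theorem integral_abs_sub_sub_abs {f : ℝ → ℝ} (hf : Continuous f) (hf0 : ∀ s, 0 ≤ f s)
    {μ : Measure ℝ} [IsProbabilityMeasure μ]
    (hμ : μ = volume.withDensity fun s => ENNReal.ofReal (f s))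
    (hmed : μ (Set.Iic 0) = 1 / 2) (u : ℝ) :
    ∫ s, (|s - u| - |s|) ∂μ = u ^ 2 * averagedDensity f u := by
  have hind : Integrable (fun s => 2 * (Set.Iic (0 : ℝ)).indicator (1 : ℝ → ℝ) s) μ :=
    ((integrable_const (1 : ℝ)).indicator measurableSet_Iic).const_mul 2
  have hsign : ∫ s, u * (2 * (Set.Iic (0 : ℝ)).indicator 1 s - 1) ∂μ = 0 := by
    rw [integral_const_mul, integral_sub hind (integrable_const 1), integral_const_mul,
      integral_indicator_one measurableSet_Iic]
    simp [measureReal_def, hmed]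
  have hint : Integrable (fun s => u * (2 * (Set.Iic (0 : ℝ)).indicator 1 s - 1)) μ :=
    (hind.sub (integrable_const 1)).const_mul u
  have hremint (a b : ℝ) (c : ℝ) :
      Integrable ((Set.Ioc a b).indicator fun s => c * (2 * (u - s))) μ :=
    (ContinuousOn.integrableOn_of_subset_isCompact (K := Set.Icc a b) (by fun_prop)
      isCompact_Icc measurableSet_Ioc Set.Ioc_subset_Icc_self
      (measure_ne_top _ _)).integrable_indicator measurableSet_Ioc
  rw [sq_mul_averagedDensity]
  rcases le_total 0 u with hu | hu
  · have key (s : ℝ) : |s - u| - |s| = u * (2 * (Set.Iic (0 : ℝ)).indicator 1 s - 1)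
        + (Set.Ioc 0 u).indicator (fun s => 1 * (2 * (u - s))) s := by
      simp only [Set.indicator_apply, Set.mem_Iic, Set.mem_Ioc, Pi.one_apply]
      split_ifs <;> grind
    simp_rw [key]
    rw [integral_add hint (hremint _ _ _), hsign, zero_add, integral_indicator measurableSet_Ioc,
      intervalIntegral.integral_of_le hu, hμ,
      setIntegral_withDensity_ofReal hf hf0 measurableSet_Ioc]
    simp
  · have key (s : ℝ) : |s - u| - |s| = u * (2 * (Set.Iic (0 : ℝ)).indicator 1 s - 1)
        + (Set.Ioc u 0).indicator (fun s => (-1) * (2 * (u - s))) s := by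
      simp only [Set.indicator_apply, Set.mem_Iic, Set.mem_Ioc, Pi.one_apply]
      split_ifs <;> grind
    simp_rw [key]
    rw [integral_add hint (hremint _ _ _), hsign, zero_add, integral_indicator measurableSet_Ioc,
      intervalIntegral.integral_of_ge hu, hμ,
      setIntegral_withDensity_ofReal hf hf0 measurableSet_Ioc, ← integral_neg]
    simp

theorem integrable_inner_sq {Ω : Type*} [MeasurableSpace Ω] {P : Measure Ω}
    {E : Type*} [NormedAddCommGroup E] [InnerProductSpace ℝ E] {X : Ω → E}
    (hX : AEStronglyMeasurable X P) (hX2 : Integrable (fun ω => ‖X ω‖ ^ 2) P) (δ : E) :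
    Integrable (fun ω => ⟪X ω, δ⟫ ^ 2) P := by
  refine (hX2.mul_const (‖δ‖ ^ 2)).mono' ((hX.inner aestronglyMeasurable_const).pow 2) ?_
  refine .of_forall fun ω => ?_
  rw [norm_pow, ← mul_pow]
  exact pow_le_pow_left₀ (norm_nonneg _) (norm_inner_le_norm _ _) 2

theorem integral_inner_sq_eq_sum {Ω : Type*} [MeasurableSpace Ω] {P : Measure Ω} {p : ℕ}
    {X : Ω → EuclideanSpace ℝ (Fin p)} (hX : Measurable X)
    (hX2 : Integrable (fun ω => ‖X ω‖ ^ 2) P) (δ : EuclideanSpace ℝ (Fin p)) :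
    ∫ ω, ⟪X ω, δ⟫ ^ 2 ∂P = ∑ i, ∑ j, δ i * (∫ ω, X ω i * X ω j ∂P) * δ j := by
  have hint (i j : Fin p) : Integrable (fun ω => X ω i * X ω j) P := by
    refine hX2.mono' (by fun_prop) (.of_forall fun ω => ?_)
    rw [norm_mul, pow_two]
    exact mul_le_mul (PiLp.norm_apply_le _ _) (PiLp.norm_apply_le _ _) (norm_nonneg _)
      (norm_nonneg _)
  have hexp (ω : Ω) : ⟪X ω, δ⟫ ^ 2 = ∑ i, ∑ j, δ i * (X ω i * X ω j) * δ j := by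
    rw [PiLp.inner_apply, pow_two, Finset.sum_mul_sum]
    refine Finset.sum_congr rfl fun i _ => Finset.sum_congr rfl fun j _ => ?_
    simp only [RCLike.inner_apply, conj_trivial]
    ring
  simp_rw [hexp]
  rw [integral_finsetSum _ fun i _ => integrable_finsetSum _ fun j _ =>
    ((hint i j).const_mul _).mul_const _]
  refine Finset.sum_congr rfl fun i _ => ?_
  rw [integral_finsetSum _ fun j _ => ((hint i j).const_mul _).mul_const _]
  refine Finset.sum_congr rfl fun j _ => ?_
  rw [integral_mul_const, integral_const_mul]

theorem ladLimitContrast_add_sub {Ω : Type*} [MeasurableSpace Ω] {P : Measure Ω}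
    [IsProbabilityMeasure P] {p : ℕ} {X : Ω → EuclideanSpace ℝ (Fin p)} (hX : Measurable X)
    (hX1 : Integrable X P) {e : Ω → ℝ} (he : Measurable e) (heint : Integrable e P)
    (hindep : IndepFun X e P) (β δ : EuclideanSpace ℝ (Fin p)) :
    ladLimitContrast P X e β (β + δ) - ladLimitContrast P X e β β =
      ∫ ω, (∫ s, (|s - ⟪X ω, δ⟫| - |s|) ∂(P.map e)) ∂P := by
  have hinner : Integrable (fun ω => ⟪X ω, δ⟫) P := hX1.inner_const δ
  have hsub : Integrable (fun ω => |e ω - ⟪X ω, δ⟫|) P := (heint.sub hinner).abs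
  have : IsProbabilityMeasure (P.map e) := Measure.isProbabilityMeasure_map he.aemeasurable
  have : IsProbabilityMeasure (P.map X) := Measure.isProbabilityMeasure_map hX.aemeasurable
  have hprod : P.map (fun ω => (X ω, e ω)) = (P.map X).prod (P.map e) :=
    (indepFun_iff_map_prod_eq_prod_map_map hX.aemeasurable he.aemeasurable).1 hindep
  have hg : StronglyMeasurable
      (fun z : EuclideanSpace ℝ (Fin p) × ℝ => |z.2 - ⟪z.1, δ⟫| - |z.2|) :=
    Continuous.stronglyMeasurable (by fun_prop)
  have hgint : Integrable (fun z : EuclideanSpace ℝ (Fin p) × ℝ => |z.2 - ⟪z.1, δ⟫| - |z.2|)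
      ((P.map X).prod (P.map e)) := by
    rw [← hprod, integrable_map_measure hg.aestronglyMeasurable (hX.prodMk he).aemeasurable]
    exact hsub.sub heint.abs
  have hinnerMeas : StronglyMeasurable fun x : EuclideanSpace ℝ (Fin p) =>
      ∫ s, (|s - ⟪x, δ⟫| - |s|) ∂(P.map e) := hg.integral_prod_right'
  calc ladLimitContrast P X e β (β + δ) - ladLimitContrast P X e β β
      = ∫ ω, (|e ω - ⟪X ω, δ⟫| - |e ω|) ∂P := by
        rw [integral_sub hsub heint.abs]
        simp [ladLimitContrast, sub_eq_add_neg]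
    _ = ∫ z, (|z.2 - ⟪z.1, δ⟫| - |z.2|) ∂(P.map fun ω => (X ω, e ω)) :=
        (integral_map (hX.prodMk he).aemeasurable hg.aestronglyMeasurable).symm
    _ = ∫ x, (∫ s, (|s - ⟪x, δ⟫| - |s|) ∂(P.map e)) ∂(P.map X) := by
        rw [hprod, integral_prod _ hgint]
    _ = _ := integral_map hX.aemeasurable hinnerMeas.aestronglyMeasurable

/-- If `k` is bounded and continuous and `k 0 = 0`, then `E[⟪X, δ⟫² k(⟪X, δ⟫)] = o(‖δ‖²)`. -/
theorem isLittleO_integral_inner_sq_mul {Ω : Type*} [MeasurableSpace Ω] {P : Measure Ω}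
    {E : Type*} [NormedAddCommGroup E] [InnerProductSpace ℝ E] {X : Ω → E}
    (hX : AEStronglyMeasurable X P) (hX2 : Integrable (fun ω => ‖X ω‖ ^ 2) P) {k : ℝ → ℝ}
    (hk : Continuous k) (hk0 : k 0 = 0) {C : ℝ} (hC : ∀ u, |k u| ≤ C) :
    (fun δ : E => ∫ ω, ⟪X ω, δ⟫ ^ 2 * k ⟪X ω, δ⟫ ∂P) =o[𝓝 0] fun δ => ‖δ‖ ^ 2 := by
  have hmeas (δ : E) : AEStronglyMeasurable (fun ω => ‖X ω‖ ^ 2 * |k ⟪X ω, δ⟫|) P :=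
    (hX.norm.pow 2).mul
      ((hk.abs).comp_aestronglyMeasurable (hX.inner aestronglyMeasurable_const))
  have hbound (δ : E) (ω : Ω) : ‖‖X ω‖ ^ 2 * |k ⟪X ω, δ⟫|‖ ≤ ‖X ω‖ ^ 2 * C := by
    rw [Real.norm_of_nonneg (by positivity)]
    exact mul_le_mul_of_nonneg_left (hC _) (by positivity)
  have hlim : Filter.Tendsto (fun δ : E => ∫ ω, ‖X ω‖ ^ 2 * |k ⟪X ω, δ⟫| ∂P) (𝓝 0) (𝓝 0) := by
    have hcont : ContinuousAt (fun δ : E => ∫ ω, ‖X ω‖ ^ 2 * |k ⟪X ω, δ⟫| ∂P) 0 :=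
      continuousAt_of_dominated (.of_forall hmeas)
        (.of_forall fun δ => .of_forall (hbound δ)) (hX2.mul_const C)
        (.of_forall fun ω => Continuous.continuousAt (by fun_prop))
    simpa [ContinuousAt, hk0] using hcont
  have hO : (fun δ : E => ∫ ω, ⟪X ω, δ⟫ ^ 2 * k ⟪X ω, δ⟫ ∂P) =O[𝓝 0]
      fun δ => ‖δ‖ ^ 2 * ∫ ω, ‖X ω‖ ^ 2 * |k ⟪X ω, δ⟫| ∂P := by
    refine .of_bound' (.of_forall fun δ => (le_abs_self _).trans' ?_)
    rw [← integral_const_mul]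
    refine norm_integral_le_of_norm_le
      (((hX2.mul_const C).mono' (hmeas δ) (.of_forall (hbound δ))).const_mul _)
      (.of_forall fun ω => ?_)
    rw [norm_mul, norm_pow, Real.norm_eq_abs (k _), ← mul_assoc, ← mul_pow, mul_comm ‖δ‖]
    gcongr
    exact norm_inner_le_norm _ _
  refine hO.trans_isLittleO ?_
  simpa using (isBigO_refl (fun δ : E => ‖δ‖ ^ 2) (𝓝 0)).mul_isLittleO
    ((isLittleO_one_iff ℝ).2 hlim)

/-- Second-order expansion of the LAD limit contrast at `β`:
`G(β + δ) = G(β) + f(0)·δᵀ E[xxᵀ] δ + o(‖δ‖²)`, i.e. `G` has first derivative `0` and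
second derivative `Γ = 2f(0)·E[xxᵀ]` at `β`. -/
theorem ladLimitContrast_second_order_expansion
    {Ω : Type*} [MeasurableSpace Ω] (P : Measure Ω) [IsProbabilityMeasure P]
    {p : ℕ} (X : Ω → EuclideanSpace ℝ (Fin p)) (hXmeas : Measurable X)
    (hX2 : Integrable (fun ω => ‖X ω‖ ^ 2) P)
    (e : Ω → ℝ) (hemeas : Measurable e) (heint : Integrable e P)
    (hindep : IndepFun X e P)
    -- ε has a bounded continuous density f
    (f : ℝ → ℝ) (hfcont : Continuous f) (hfnonneg : ∀ s, 0 ≤ f s)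
    (hfbdd : ∃ M : ℝ, ∀ s, f s ≤ M)
    (hdens : P.map e = volume.withDensity fun s => ENNReal.ofReal (f s))
    -- the cdf of ε satisfies F(0) = 1/2
    (hF0 : P {ω | e ω ≤ 0} = 1/2)
    (β : EuclideanSpace ℝ (Fin p)) :
    (fun δ : EuclideanSpace ℝ (Fin p) =>
        ladLimitContrast P X e β (β + δ) - ladLimitContrast P X e β β
          - f 0 * ∑ i, ∑ j, δ i * (∫ ω, X ω i * X ω j ∂P) * δ j)
      =o[𝓝 0] fun δ => ‖δ‖ ^ 2 := by
  obtain ⟨M, hM⟩ := hfbdd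
  have hX2' : MemLp X 2 P := (memLp_two_iff_integrable_sq_norm hXmeas.aestronglyMeasurable).2 hX2
  have : IsProbabilityMeasure (P.map e) := Measure.isProbabilityMeasure_map hemeas.aemeasurable
  have hmed : P.map e (Set.Iic 0) = 1 / 2 := by
    rw [Measure.map_apply hemeas measurableSet_Iic]
    exact hF0
  have hk := continuous_averagedDensity hfcont
  have hCb (u : ℝ) : |averagedDensity f u - f 0| ≤ 2 * M + |f 0| :=
    (abs_sub _ _).trans (by gcongr; exact abs_averagedDensity_le hfnonneg hM u)
  refine (isLittleO_integral_inner_sq_mul hXmeas.aestronglyMeasurable hX2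
    (k := fun u => averagedDensity f u - f 0) (by fun_prop)
    (by simp [averagedDensity_zero]) hCb).congr_left fun δ => ?_
  have hsq := integrable_inner_sq hXmeas.aestronglyMeasurable hX2 δ
  rw [ladLimitContrast_add_sub hXmeas (hX2'.integrable one_le_two) hemeas heint hindep,
    ← integral_inner_sq_eq_sum hXmeas hX2, ← integral_const_mul]
  simp_rw [integral_abs_sub_sub_abs hfcont hfnonneg hdens hmed]
  rw [← integral_sub _ (hsq.const_mul _)]
  · congr 1 with ω
    ring
  · refine hsq.mul_bdd (c := 2 * M) ?_
      (.of_forall fun ω => abs_averagedDensity_le hfnonneg hM _)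
    exact hk.comp_aestronglyMeasurable
      (hXmeas.aestronglyMeasurable.inner aestronglyMeasurable_const)
end

section
/- Let (Ω,F,P) be a probability space, (Φ,d) a metric space, T a nonempty set, Λ_n : Ω × Φ × T → ℝ maps, β : T → Φ, and β̂_n : Ω × T → Φ maps such that: (A) sup_{t∈T} max(Λ_n(β̂_n(t),t) − Λ_n(β(t),t), 0) = O_{P*}(n^{−1}); (B) sup_{t∈T} d(β̂_n(t),β(t)) converges to 0 in outer probability. Assume the decomposition Λ_n(φ,t) − Λ_n(β(t),t) = G_n(φ,t) + H(φ,t) + d(φ,β(t))·R_n(φ,t) holds, where: (i) sup_{φ∈Φ} sup_{t∈T} n·|G_n(φ,t)|/(1 + √n·d(φ,β(t))) = O_{P*}(1); (ii) there exists ε > 0 with inf_{t∈T} inf{ H(φ,t)/d(φ,β(t))² : φ ∈ Φ, 0 < d(φ,β(t)) ≤ ε } > 0; (iii) for every sequence of maps r_n : Ω → (0,∞) converging to 0 in outer probability there exist maps a_n, b_n : Ω → [0,∞) such that sup_{t∈T} sup{ |R_n(φ,t)| : φ ∈ Φ, d(φ,β(t)) ≤ r_n } ≤ a_n + b_n, with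 a_n/r_n converging to 0 in outer probability and b_n = O_{P*}(n^{−1/2}). Then √n·sup_{t∈T} d(β̂_n(t),β(t)) = O_{P*}(1). -/
open MeasureTheory Filter Topology
open scoped ENNReal

/-- A sequence of (possibly nonmeasurable) real-valued maps converges to `0`
in outer probability. -/
def TendstoOuterZeroReal {Ω : Type*} [MeasurableSpace Ω] (P : Measure Ω)
    (Y : ℕ → Ω → ℝ) : Prop :=
  ∀ ε : ℝ, 0 < ε → Tendsto (fun n => P {ω | ε ≤ |Y n ω|}) atTop (𝓝 0)

/-- `Yₙ = O_{P*}(aₙ)` : for every `ε > 0` there is `M > 0` with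
`limsupₙ P*(Yₙ > M·aₙ) ≤ ε`. -/
def BigOPStar {Ω : Type*} [MeasurableSpace Ω] (P : Measure Ω)
    (Y : ℕ → Ω → ℝ≥0∞) (a : ℕ → ℝ≥0∞) : Prop :=
  ∀ ε : ℝ, 0 < ε → ∃ M : ℝ, 0 < M ∧
    limsup (fun n => P {ω | ENNReal.ofReal M * a n < Y n ω}) atTop ≤ ENNReal.ofReal ε

theorem le_of_quadratic_bound {c A G B x : ℝ} (hc : 0 < c) (hA : 0 ≤ A) (hG : 0 ≤ G)
    (hx : c * x ^ 2 ≤ A + G * (1 + x) + x * (c / 4 * (2 * x + 1) + B)) :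
    x ≤ max 1 (2 * (A + 2 * G + c / 4 + B) / c) := by
  by_contra! h
  obtain ⟨h1, h2⟩ := max_lt_iff.1 h
  rw [div_lt_iff₀ hc] at h2
  nlinarith [mul_lt_mul_of_pos_right h2 (by linarith : 0 < x),
    mul_nonneg hA (by linarith : 0 ≤ x - 1), mul_nonneg hG (by linarith : 0 ≤ x - 1)]

/-- The deterministic rate bound obtained from the quadratic lower bound on `h` and the
bounds on the remaining terms of the decomposition `l = g + h + d * R`. -/
theorem sqrt_mul_le_of_decomposition {c A G B n s d l g h R a b : ℝ} (hc : 0 < c)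
    (hA : 0 ≤ A) (hG : 0 ≤ G) (hn : 1 ≤ n) (hd : 0 < d) (hs : 0 ≤ s) (hsd : s < 2 * d)
    (hh : c * d ^ 2 ≤ h) (hdec : l = g + h + d * R) (hl : l ≤ A / n)
    (hg : n * |g| / (1 + √n * d) ≤ G) (hR : |R| ≤ a + b)
    (ha : a / (s + 1 / (n + 1)) ≤ c / 4) (hb : b ≤ B * n ^ (-(1 / 2) : ℝ)) :
    √n * d ≤ max 1 (2 * (A + 2 * G + c / 4 + B) / c) := by
  have hn0 : 0 < n := by linarith
  have hq1 : 1 ≤ √n := Real.one_le_sqrt.2 hn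
  have hq0 : 0 < √n := by linarith
  have hqq : √n * √n = n := Real.mul_self_sqrt hn0.le
  have hx : 0 < √n * d := by positivity
  rw [Real.rpow_neg hn0.le, ← Real.sqrt_eq_rpow, ← div_eq_mul_inv, le_div_iff₀ hq0] at hb
  rw [div_le_iff₀ (by positivity)] at ha hg
  rw [le_div_iff₀ hn0] at hl
  have hinv : √n * (1 / (n + 1)) ≤ 1 := by
    rw [mul_one_div, div_le_one (by linarith)]
    nlinarith
  have hqs : √n * (s + 1 / (n + 1)) ≤ 2 * (√n * d) + 1 := by nlinarith
  have hqR : √n * |R| ≤ c / 4 * (2 * (√n * d) + 1) + B := by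
    calc √n * |R| ≤ √n * a + b * √n := by nlinarith
      _ ≤ √n * (c / 4 * (s + 1 / (n + 1))) + B := by gcongr
      _ = c / 4 * (√n * (s + 1 / (n + 1))) + B := by ring
      _ ≤ _ := by gcongr
  have hdR : -(n * (d * R)) ≤ √n * d * (√n * |R|) := by
    calc -(n * (d * R)) = n * d * -R := by ring
      _ ≤ n * d * |R| := by gcongr; exact neg_le_abs R
      _ = √n * d * (√n * |R|) := by rw [← hqq]; simp only [Real.sqrt_mul_self hq0.le]; ring
  refine le_of_quadratic_bound hc hA hG ?_
  calc c * (√n * d) ^ 2 = n * (c * d ^ 2) := by rw [mul_pow, sq (√n), hqq]; ring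
    _ ≤ n * h := by gcongr
    _ = l * n + n * -g + -(n * (d * R)) := by rw [hdec]; ring
    _ ≤ A + n * |g| + √n * d * (√n * |R|) := by
      gcongr
      exact neg_le_abs g
    _ ≤ _ := by gcongr

section OuterProbability

variable {Ω : Type*} [MeasurableSpace Ω] {P : Measure Ω}

theorem BigOPStar.exists_eventually_le {Y : ℕ → Ω → ℝ≥0∞} {a : ℕ → ℝ≥0∞}
    (h : BigOPStar P Y a) {ε : ℝ} (hε : 0 < ε) :
    ∃ M : ℝ, 0 < M ∧
      ∀ᶠ n in atTop, P {ω | ENNReal.ofReal M * a n < Y n ω} ≤ ENNReal.ofReal ε := by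
  obtain ⟨M, hM, hlim⟩ := h (ε / 2) (half_pos hε)
  refine ⟨M, hM, (eventually_lt_of_limsup_lt (hlim.trans_lt ?_)).mono fun _ => le_of_lt⟩
  exact (ENNReal.ofReal_lt_ofReal_iff hε).2 (half_lt_self hε)

theorem bigOPStar_of_forall_exists_eventually_le {Y : ℕ → Ω → ℝ≥0∞} {a : ℕ → ℝ≥0∞}
    (h : ∀ ε : ℝ, 0 < ε → ∃ M : ℝ, 0 < M ∧
      ∀ᶠ n in atTop, P {ω | ENNReal.ofReal M * a n < Y n ω} ≤ ENNReal.ofReal ε) :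
    BigOPStar P Y a := fun ε hε =>
  let ⟨M, hM, hev⟩ := h ε hε
  ⟨M, hM, limsup_le_of_le (by isBoundedDefault) hev⟩

theorem TendstoOuterZero.toReal_add_one_div {Y : ℕ → Ω → ℝ≥0∞} (h : TendstoOuterZero P Y) :
    TendstoOuterZeroReal P fun n ω => (Y n ω).toReal + 1 / ((n : ℝ) + 1) := by
  intro ε hε
  refine tendsto_of_tendsto_of_tendsto_of_le_of_le' tendsto_const_nhds (h (ε / 2) (half_pos hε))
    (Eventually.of_forall fun _ => zero_le) ?_
  filter_upwards [tendsto_one_div_add_atTop_nhds_zero_nat.eventually_lt_const (half_pos hε)]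
    with n hn
  refine measure_mono fun ω hω => ?_
  simp only [Set.mem_ofPred_eq] at hω ⊢
  rw [abs_of_nonneg (by positivity)] at hω
  exact ENNReal.ofReal_le_of_le_toReal (by linarith)

end OuterProbability

/-- Rate of convergence of pathwise M-estimators (Proposition 2 of the paper):
`√n·sup_{t∈T} d(β̂ₙ(t),β(t)) = O_{P*}(1)`. -/
theorem pathwise_rate_of_convergence
    {Ω : Type*} [MeasurableSpace Ω] (P : Measure Ω) [IsProbabilityMeasure P]
    {Φ : Type*} [MetricSpace Φ] {T : Type*} [Nonempty T]
    (Λn : ℕ → Ω → Φ → T → ℝ) (β : T → Φ) (βhat : ℕ → Ω → T → Φ)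
    (Gn : ℕ → Ω → Φ → T → ℝ) (H : Φ → T → ℝ) (Rn : ℕ → Ω → Φ → T → ℝ)
    -- (A) sup_{t∈T} (Λₙ(β̂ₙ(t),t) − Λₙ(β(t),t))₊ = O_{P*}(n⁻¹)
    (hA : BigOPStar P (fun n ω => ⨆ t : T,
        ENNReal.ofReal (max (Λn n ω (βhat n ω t) t - Λn n ω (β t) t) 0))
      (fun n => ((n : ℝ≥0∞))⁻¹))
    -- (B) sup_{t∈T} d(β̂ₙ(t),β(t)) → 0 in outer probability
    (hB : TendstoOuterZero P fun n ω => ⨆ t : T, edist (βhat n ω t) (β t))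
    -- decomposition of the contrast process
    (hdecomp : ∀ n ω (φ : Φ) (t : T), Λn n ω φ t - Λn n ω (β t) t
      = Gn n ω φ t + H φ t + dist φ (β t) * Rn n ω φ t)
    -- (i) sup_{φ,t} n|Gₙ(φ,t)|/(1 + √n·d(φ,β(t))) = O_{P*}(1)
    (hG : BigOPStar P (fun n ω => ⨆ φ : Φ, ⨆ t : T,
        ENNReal.ofReal ((n : ℝ) * |Gn n ω φ t| / (1 + Real.sqrt n * dist φ (β t))))
      (fun _ => 1))
    -- (ii) ∃ ε > 0 with inf_{t∈T} inf {H(φ,t)/d(φ,β(t))² : 0 < d(φ,β(t)) ≤ ε} > 0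
    (hH : ∃ ε : ℝ, 0 < ε ∧ ∃ c : ℝ, 0 < c ∧ ∀ (t : T) (φ : Φ),
      0 < dist φ (β t) → dist φ (β t) ≤ ε → c * dist φ (β t) ^ 2 ≤ H φ t)
    -- (iii) the remainder term is controlled on shrinking balls
    (hR : ∀ r : ℕ → Ω → ℝ, (∀ n ω, 0 < r n ω) → TendstoOuterZeroReal P r →
      ∃ a b : ℕ → Ω → ℝ, (∀ n ω, 0 ≤ a n ω) ∧ (∀ n ω, 0 ≤ b n ω) ∧
        (∀ n ω (t : T) (φ : Φ), dist φ (β t) ≤ r n ω → |Rn n ω φ t| ≤ a n ω + b n ω) ∧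
        TendstoOuterZeroReal P (fun n ω => a n ω / r n ω) ∧
        BigOPStar P (fun n ω => ENNReal.ofReal (b n ω))
          (fun n => ENNReal.ofReal ((n : ℝ) ^ (-(1/2) : ℝ)))) :
    BigOPStar P (fun n ω => ENNReal.ofReal (Real.sqrt n) * ⨆ t : T, edist (βhat n ω t) (β t))
      (fun _ => 1) := by
  obtain ⟨δ, hδ, c, hc, hH⟩ := hH
  set S : ℕ → Ω → ℝ≥0∞ := fun n ω => ⨆ t : T, edist (βhat n ω t) (β t)
  obtain ⟨a, b, -, -, hRab, har, hbO⟩ :=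
    hR (fun n ω => (S n ω).toReal + 1 / ((n : ℝ) + 1)) (fun n ω => by positivity)
      hB.toReal_add_one_div
  refine bigOPStar_of_forall_exists_eventually_le fun ε hε => ?_
  have hε5 : 0 < ε / 5 := by positivity
  obtain ⟨A, hA0, hA⟩ := hA.exists_eventually_le hε5
  obtain ⟨G, hG0, hG⟩ := hG.exists_eventually_le hε5
  obtain ⟨B, hB0, hbO⟩ := hbO.exists_eventually_le hε5
  have hc4 : 0 < c / 4 := by positivity
  have hpos : 0 < ENNReal.ofReal (ε / 5) := ENNReal.ofReal_pos.2 hε5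
  set K := max 1 (2 * (A + 2 * G + c / 4 + B) / c)
  have hK1 : 1 ≤ K := le_max_left _ _
  refine ⟨2 * K, by linarith, ?_⟩
  filter_upwards [hA, hG, hbO, (hB δ hδ).eventually_le_const hpos,
    (har _ hc4).eventually_le_const hpos, eventually_ge_atTop 1] with n eA eG eb eS ea hn
  have hn1 : (1 : ℝ) ≤ n := by exact_mod_cast hn
  have hn0 : (0 : ℝ) < n := by linarith
  refine (measure_mono (t := _ ∪ (_ ∪ (_ ∪ (_ ∪ _)))) fun ω hω => ?_).trans <|
    (measure_union_le _ _).trans <| (add_le_add eA <| (measure_union_le _ _).trans <|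
    add_le_add eG <| (measure_union_le _ _).trans <| add_le_add eb <|
    (measure_union_le _ _).trans <| add_le_add eS ea).trans ?_
  · by_contra hgood
    simp only [Set.mem_union, Set.mem_ofPred_eq, not_or, not_lt, not_le, mul_one] at hgood hω
    obtain ⟨gA, gG, gb, gS, ga⟩ := hgood
    have hStop : S n ω ≠ ∞ := gS.ne_top
    have hsK : 2 * K < √n * (S n ω).toReal := by
      change _ < _ * S n ω at hω
      rw [← ENNReal.ofReal_toReal hStop, ← ENNReal.ofReal_mul (by positivity)] at hω
      exact (ENNReal.ofReal_lt_ofReal_iff_of_nonneg (by linarith)).1 hω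
    have hs0 : 0 < (S n ω).toReal := by
      by_contra! h
      nlinarith [Real.sqrt_nonneg (n : ℝ)]
    have hd_le (t : T) : dist (βhat n ω t) (β t) ≤ (S n ω).toReal := by
      rw [dist_edist]
      exact ENNReal.toReal_mono hStop (le_iSup (fun t => edist (βhat n ω t) (β t)) t)
    obtain ⟨t, ht⟩ : ∃ t, ENNReal.ofReal ((S n ω).toReal / 2) < edist (βhat n ω t) (β t) := by
      refine lt_iSup_iff.1 ((ENNReal.ofReal_lt_iff_lt_toReal (by positivity) hStop).2 ?_)
      linarith
    rw [edist_dist, ENNReal.ofReal_lt_ofReal_iff_of_nonneg (by positivity)] at ht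
    have hd0 : 0 < dist (βhat n ω t) (β t) := by linarith
    have hSδ : (S n ω).toReal < δ := (ENNReal.lt_ofReal_iff_toReal_lt hStop).1 gS
    have hl : Λn n ω (βhat n ω t) t - Λn n ω (β t) t ≤ A / n := by
      have h := (le_iSup (fun t : T =>
        ENNReal.ofReal (max (Λn n ω (βhat n ω t) t - Λn n ω (β t) t) 0)) t).trans gA
      rw [← ENNReal.ofReal_natCast, ← ENNReal.ofReal_inv_of_pos hn0,
        ← ENNReal.ofReal_mul hA0.le, ENNReal.ofReal_le_ofReal_iff (by positivity)] at h
      exact (le_max_left _ _).trans h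
    have hg : (n : ℝ) * |Gn n ω (βhat n ω t) t| / (1 + √n * dist (βhat n ω t) (β t)) ≤ G :=
      (ENNReal.ofReal_le_ofReal_iff hG0.le).1 <|
        (le_iSup₂ (f := fun φ t => ENNReal.ofReal ((n : ℝ) * |Gn n ω φ t| /
          (1 + √n * dist φ (β t)))) (βhat n ω t) t).trans gG
    have hb : b n ω ≤ B * (n : ℝ) ^ (-(1 / 2) : ℝ) := by
      rwa [← ENNReal.ofReal_mul hB0.le, ENNReal.ofReal_le_ofReal_iff (by positivity)] at gb
    have hKd := sqrt_mul_le_of_decomposition hc hA0.le hG0.le hn1 hd0 hs0.le (by linarith)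
      (hH t _ hd0 ((hd_le t).trans hSδ.le)) (hdecomp n ω _ t) hl hg
      (hRab n ω t _ ((hd_le t).trans (le_add_of_nonneg_right (by positivity))))
      ((le_abs_self _).trans ga.le) hb
    have := mul_lt_mul_of_pos_left ht (Real.sqrt_pos.2 hn0)
    linarith
  · repeat rw [← ENNReal.ofReal_add (by positivity) (by positivity)]
    exact ENNReal.ofReal_le_ofReal (by linarith)
end

section
/- Fix p ≥ 1 and β ∈ ℝ^p, and define the ℓ⁰ penalty J_n^{(0)}(φ) = n^{−1}·#{k ∈ {1,…,p} : φ_k ≠ 0} and J_∞^{(0)}(φ) = #{k ∈ {1,…,p} : β_k = 0 and φ_k ≠ 0}. Then for every r > 0 there exists N such that for all n ≥ N and all φ ∈ ℝ^p with ‖φ‖ ≤ r, n·J_n^{(0)}(β + n^{−1/2}φ) − n·J_n^{(0)}(β) = J_∞^{(0)}(φ). -/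
/-- The `ℓ⁰` (AIC-type) penalty `J_n^{(0)}(φ) = n⁻¹·#{k : φ_k ≠ 0}`. -/
noncomputable def Jpen0 {p : ℕ} (n : ℕ) (φ : EuclideanSpace ℝ (Fin p)) : ℝ :=
  (n : ℝ)⁻¹ * (Finset.univ.filter fun k : Fin p => φ k ≠ 0).card

theorem mul_Jpen0 {p n : ℕ} (hn : n ≠ 0) (φ : EuclideanSpace ℝ (Fin p)) :
    (n : ℝ) * Jpen0 n φ = (Finset.univ.filter fun k : Fin p => φ k ≠ 0).card :=
  mul_inv_cancel_left₀ (Nat.cast_ne_zero.mpr hn) _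

/-- A perturbation too small to cancel the nonzero coordinates of `β` enlarges its support by
exactly the coordinates of the perturbation lying outside that support. -/
theorem card_support_add_smul {p : ℕ} {β φ : EuclideanSpace ℝ (Fin p)} {c r : ℝ} (hc : 0 < c)
    (hφ : ‖φ‖ ≤ r) (hβ : ∀ k, β k ≠ 0 → c * r < |β k|) :
    (Finset.univ.filter fun k : Fin p => (β + c • φ) k ≠ 0).card =
      (Finset.univ.filter fun k : Fin p => β k ≠ 0).card +
        (Finset.univ.filter fun k : Fin p => β k = 0 ∧ φ k ≠ 0).card := by
  rw [← Finset.card_union_of_disjoint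
    (Finset.disjoint_filter.mpr fun k _ h h' => h h'.1), ← Finset.filter_or]
  congr 1
  refine Finset.filter_congr fun k _ => ?_
  simp only [PiLp.add_apply, PiLp.smul_apply, smul_eq_mul]
  by_cases hk : β k = 0
  · simp [hk, hc.ne']
  · refine iff_of_true (fun h => ?_) (Or.inl hk)
    have hk' : |φ k| ≤ r := (PiLp.norm_apply_le φ k).trans hφ
    have habs : |β k| = c * |φ k| := by
      rw [eq_neg_of_add_eq_zero_left h, abs_neg, abs_mul, abs_of_pos hc]
    exact (hβ k hk).not_ge (habs ▸ mul_le_mul_of_nonneg_left hk' hc.le)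

/-- Rescaled `ℓ⁰` penalty: for every `r > 0`, for all `n` large enough and all `‖φ‖ ≤ r`,
`n·J_n^{(0)}(β + n^{−1/2}φ) − n·J_n^{(0)}(β) = J_∞^{(0)}(φ)` where
`J_∞^{(0)}(φ) = #{k : β_k = 0 and φ_k ≠ 0}`. -/
theorem Jpen0_rescaled_eventually_eq
    {p : ℕ} (hp : 1 ≤ p) (β : EuclideanSpace ℝ (Fin p)) :
    ∀ r : ℝ, 0 < r → ∃ N : ℕ, ∀ n ≥ N, ∀ φ : EuclideanSpace ℝ (Fin p), ‖φ‖ ≤ r →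
      (n : ℝ) * Jpen0 n (β + ((n : ℝ) ^ (-(1/2) : ℝ)) • φ) - (n : ℝ) * Jpen0 n β
        = (Finset.univ.filter fun k : Fin p => β k = 0 ∧ φ k ≠ 0).card := by
  intro r _
  have hlim : Filter.Tendsto (fun n : ℕ => (n : ℝ) ^ (-(1/2) : ℝ) * r) Filter.atTop (nhds 0) := by
    simpa using ((tendsto_rpow_neg_atTop (by norm_num : (0 : ℝ) < 1 / 2)).comp
      tendsto_natCast_atTop_atTop).mul_const r
  have hsmall : ∀ᶠ n : ℕ in Filter.atTop,
      ∀ k, β k ≠ 0 → (n : ℝ) ^ (-(1/2) : ℝ) * r < |β k| := by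
    refine Filter.eventually_all.mpr fun k => ?_
    by_cases hk : β k = 0
    · simp [hk]
    · filter_upwards [hlim.eventually_lt_const (abs_pos.mpr hk)] with n hn _ using hn
  obtain ⟨N, hN⟩ := Filter.eventually_atTop.mp (hsmall.and (Filter.eventually_ne_atTop 0))
  refine ⟨N, fun n hn φ hφ => ?_⟩
  obtain ⟨hβ, hn0⟩ := hN n hn
  have hc : 0 < (n : ℝ) ^ (-(1/2) : ℝ) :=
    Real.rpow_pos_of_pos (Nat.cast_pos.mpr (Nat.pos_of_ne_zero hn0)) _
  rw [mul_Jpen0 hn0, mul_Jpen0 hn0, card_support_add_smul hc hφ hβ, Nat.cast_add,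
    add_sub_cancel_left]
end

section
/- Let V be an open convex subset of ℝ^p and let M_n : Ω × V → ℝ be maps, measurable in ω for each φ ∈ V, such that for almost every ω the function M_n(ω,·) is convex on V. Let Δ : V → ℝ be a convex function and assume M_n(φ) → Δ(φ) in probability for every φ ∈ V. Then for every compact set K ⊆ V, sup_{φ∈K} |M_n(ω,φ) − Δ(φ)| → 0 in probability (this supremum is measurable since a.s.-convex functions on an open set are continuous, so it equals the supremum over a countable dense subset of K). -/
open MeasureTheory Filter Topology

/-- Closeness of convex functions on suitable finite sets forces closeness near a point. -/
theorem ConvexOn.exists_finite_nhds_abs_sub_le {E : Type*} [NormedAddCommGroup E]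
    [NormedSpace ℝ E] [FiniteDimensional ℝ E] {V : Set E} (hV : IsOpen V) {g : E → ℝ}
    (hg : ConvexOn ℝ V g) {x : E} (hx : x ∈ V) {ε : ℝ} (hε : 0 < ε) :
    ∃ U ∈ 𝓝 x, ∃ F : Set E, F.Finite ∧ F ⊆ V ∧ ∀ f : E → ℝ, ConvexOn ℝ V f →
      (∀ z ∈ F, |f z - g z| < ε / 5) → ∀ y ∈ U, |f y - g y| ≤ ε := by
  have hcont : ContinuousAt g x := (hg.continuousOn hV).continuousAt (hV.mem_nhds hx)
  have hnear : ∀ᶠ y in 𝓝 x, y ∈ V ∧ |g y - g x| < ε / 5 := by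
    have h := hcont.eventually (Metric.ball_mem_nhds (g x) (show 0 < ε / 5 by positivity))
    filter_upwards [hV.mem_nhds hx, h] with y hy hgy using ⟨hy, hgy⟩
  obtain ⟨b, hxb, hbs⟩ := exists_mem_interior_convexHull_affineBasis hnear
  set H := convexHull ℝ (Set.range b) with hH
  have hHx : H ∈ 𝓝 x := mem_interior_iff_mem_nhds.mp hxb
  have hreflect : ∀ᶠ y in 𝓝 x, (2 : ℝ) • x - y ∈ H := by
    have hc : ContinuousAt (fun y => (2 : ℝ) • x - y) x := by fun_prop
    refine hc.eventually ?_
    simpa [two_smul] using hHx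
  have hbV : Set.range b ⊆ V := fun z hz => (hbs (subset_convexHull ℝ _ hz)).1
  refine ⟨_, inter_mem hHx hreflect, insert x (Set.range b), (Set.finite_range b).insert x,
    Set.insert_subset hx hbV, ?_⟩
  rintro f hf hclose y ⟨hy, hy'⟩
  have hupper : ∀ z ∈ H, f z ≤ g x + 2 * (ε / 5) := by
    have hsub : H ⊆ {z ∈ V | f z ≤ g x + 2 * (ε / 5)} := by
      refine convexHull_min (fun z hz => ⟨hbV hz, ?_⟩) (hf.convex_le _)
      have h₁ := abs_lt.mp (hclose z (Set.mem_insert_of_mem x hz))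
      have h₂ := abs_lt.mp (hbs (subset_convexHull ℝ _ hz)).2
      linarith
    exact fun z hz => (hsub hz).2
  have hmid := hf.2 (hbs hy).1 (hbs hy').1 (show (0 : ℝ) ≤ 1 / 2 by norm_num)
    (show (0 : ℝ) ≤ 1 / 2 by norm_num) (by norm_num)
  have hxeq : (1 / 2 : ℝ) • y + (1 / 2 : ℝ) • ((2 : ℝ) • x - y) = x := by module
  rw [hxeq, smul_eq_mul, smul_eq_mul] at hmid
  have h₁ := hupper y hy
  have h₂ := hupper _ hy'
  have h₃ := abs_lt.mp (hclose x (Set.mem_insert x _))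
  have h₄ := abs_lt.mp (hbs hy).2
  rw [abs_le]
  constructor <;> linarith

/-- Closeness of convex functions on suitable finite sets forces uniform closeness on a
compact set. -/
theorem ConvexOn.exists_finite_forall_mem_isCompact_abs_sub_le {E : Type*}
    [NormedAddCommGroup E] [NormedSpace ℝ E] [FiniteDimensional ℝ E] {V : Set E}
    (hV : IsOpen V) {g : E → ℝ} (hg : ConvexOn ℝ V g) {K : Set E} (hK : IsCompact K)
    (hKV : K ⊆ V) {ε : ℝ} (hε : 0 < ε) :
    ∃ F : Set E, F.Finite ∧ F ⊆ V ∧ ∀ f : E → ℝ, ConvexOn ℝ V f →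
      (∀ z ∈ F, |f z - g z| < ε / 5) → ∀ y ∈ K, |f y - g y| ≤ ε := by
  refine hK.induction_on (p := fun S => ∃ F : Set E, F.Finite ∧ F ⊆ V ∧ ∀ f : E → ℝ,
    ConvexOn ℝ V f → (∀ z ∈ F, |f z - g z| < ε / 5) → ∀ y ∈ S, |f y - g y| ≤ ε) ?_ ?_ ?_ ?_
  · exact ⟨∅, Set.finite_empty, Set.empty_subset V, by simp⟩
  · rintro S T hST ⟨F, hF, hFV, h⟩
    exact ⟨F, hF, hFV, fun f hf hc y hy => h f hf hc y (hST hy)⟩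
  · rintro S T ⟨F, hF, hFV, hS⟩ ⟨G, hG, hGV, hT⟩
    refine ⟨F ∪ G, hF.union hG, Set.union_subset hFV hGV, fun f hf hc y hy => ?_⟩
    rcases hy with hy | hy
    · exact hS f hf (fun z hz => hc z (Or.inl hz)) y hy
    · exact hT f hf (fun z hz => hc z (Or.inr hz)) y hy
  · intro x hx
    obtain ⟨U, hU, h⟩ := hg.exists_finite_nhds_abs_sub_le hV (hKV hx) hε
    exact ⟨U, mem_nhdsWithin_of_mem_nhds hU, h⟩

/-- Convexity lemma: if `Mₙ(ω,·)` are a.s. convex on an open convex set `V ⊆ ℝ^p` and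
converge pointwise in probability to a convex function `Δ`, then the convergence is
uniform in probability on every compact subset `K` of `V`
(the supremum being over `φ ∈ K`). -/
theorem convex_pointwise_to_uniform_in_probability
    {Ω : Type*} [MeasurableSpace Ω] (P : Measure Ω) [IsProbabilityMeasure P]
    {p : ℕ} (V : Set (EuclideanSpace ℝ (Fin p))) (hVopen : IsOpen V) (hVconv : Convex ℝ V)
    (Mn : ℕ → Ω → EuclideanSpace ℝ (Fin p) → ℝ)
    (hmeas : ∀ n, ∀ φ ∈ V, Measurable fun ω => Mn n ω φ)
    (hconv : ∀ n, ∀ᵐ ω ∂P, ConvexOn ℝ V (Mn n ω))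
    (Δ : EuclideanSpace ℝ (Fin p) → ℝ) (hΔconv : ConvexOn ℝ V Δ)
    (hptwise : ∀ φ ∈ V, ∀ ε : ℝ, 0 < ε →
      Tendsto (fun n => P {ω | ε ≤ |Mn n ω φ - Δ φ|}) atTop (𝓝 0)) :
    ∀ K : Set (EuclideanSpace ℝ (Fin p)), IsCompact K → K ⊆ V →
      ∀ ε : ℝ, 0 < ε →
        Tendsto (fun n => P {ω | ε ≤ ⨆ φ : K, |Mn n ω φ - Δ φ|}) atTop (𝓝 0) := by
  intro K hK hKV ε hε
  have hε' : 0 < ε / 2 := half_pos hε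
  obtain ⟨F, hF, hFV, hclose⟩ :=
    hΔconv.exists_finite_forall_mem_isCompact_abs_sub_le hVopen hK hKV hε'
  have hsum : Tendsto (fun n => ∑ z ∈ hF.toFinset, P {ω | ε / 2 / 5 ≤ |Mn n ω z - Δ z|})
      atTop (𝓝 0) := by
    simpa using tendsto_finsetSum hF.toFinset fun z hz =>
      hptwise z (hFV (hF.mem_toFinset.mp hz)) (ε / 2 / 5) (by positivity)
  refine tendsto_of_tendsto_of_tendsto_of_le_of_le tendsto_const_nhds hsum
    (fun _ => zero_le) fun n => ?_
  refine le_trans (measure_mono_ae ?_) (measure_biUnion_finset_le _ _)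
  filter_upwards [hconv n] with ω hω hsup
  by_contra hnot
  have hF_close : ∀ z ∈ F, |Mn n ω z - Δ z| < ε / 2 / 5 := by
    intro z hz
    by_contra! hle
    exact hnot (Set.mem_biUnion (hF.mem_toFinset.mpr hz) hle)
  have hle : ⨆ φ : K, |Mn n ω φ - Δ φ| ≤ ε / 2 :=
    Real.iSup_le (fun φ => hclose _ hω hF_close φ φ.2) hε'.le
  have hsup' : ε ≤ ⨆ φ : K, |Mn n ω φ - Δ φ| := hsup
  linarith
end
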